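/- arXiv:1811.08937 — 5 statements merged into one kernel-verified Lean document; each statement's English description precedes it below -/
import Mathlib

section
/- Under the assumptions of the subsequential convergence result (f μ_f-strongly convex proper closed, g proper closed convex, existence of a primal-dual solution pair, coercivity of z ↦ g*(z)+f*(−A^Tz), C1 ≻ 0 and C2 ≻ 0, and the inexact PrePDHG iteration with bounded relative error constant c), if in addition g* is a Kurdyka–Łojasiewicz (KŁ) function, then the whole sequence (x^k, z^k) generated by inexact PrePDHG converges to a single primal-dual solution pair of minimize_x f(x)+g(Ax). -/
open Matrix Filter

noncomputable section

/-- Euclidean norm of a vector. -/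
def nrm {ι : Type*} [Fintype ι] (x : ι → ℝ) : ℝ := Real.sqrt (x ⬝ᵥ x)

/-- A function into the extended reals is proper: never `⊥` and somewhere finite. -/
def ProperE {ι : Type*} (f : (ι → ℝ) → EReal) : Prop :=
  (∃ x, f x ≠ ⊤) ∧ ∀ x, f x ≠ ⊥

/-- Convexity of an extended-real-valued function. -/
def ConvexE {ι : Type*} (f : (ι → ℝ) → EReal) : Prop :=
  ∀ x y : ι → ℝ, ∀ t : ℝ, 0 ≤ t → t ≤ 1 →
    f (t • x + (1 - t) • y) ≤ (t : EReal) * f x + ((1 - t : ℝ) : EReal) * f y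

/-- `μ`-strong convexity of an extended-real-valued function. -/
def StrongConvexE {ι : Type*} [Fintype ι] (μ : ℝ) (f : (ι → ℝ) → EReal) : Prop :=
  ∀ x y : ι → ℝ, ∀ t : ℝ, 0 ≤ t → t ≤ 1 →
    f (t • x + (1 - t) • y) + ((μ / 2 * (t * (1 - t)) * ((x - y) ⬝ᵥ (x - y)) : ℝ) : EReal) ≤
      (t : EReal) * f x + ((1 - t : ℝ) : EReal) * f y

/-- Fenchel conjugate. -/
def conjE {ι : Type*} [Fintype ι] (f : (ι → ℝ) → EReal) (y : ι → ℝ) : EReal :=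
  ⨆ x : ι → ℝ, ((x ⬝ᵥ y : ℝ) : EReal) - f x

/-- `v` is a subgradient of `f` at `x`. -/
def SubgradAt {ι : Type*} [Fintype ι] (f : (ι → ℝ) → EReal) (x v : ι → ℝ) : Prop :=
  ∀ z, f x + (((z - x) ⬝ᵥ v : ℝ) : EReal) ≤ f z

/-- `p = prox^M_φ(x)`: `p` minimizes `φ(·) + ½‖· − x‖²_M`. -/
def IsProxPt {ι : Type*} [Fintype ι] (M : Matrix ι ι ℝ) (φ : (ι → ℝ) → EReal)
    (x p : ι → ℝ) : Prop :=
  ∀ w, φ p + (((1 / 2 : ℝ) * ((p - x) ⬝ᵥ M.mulVec (p - x)) : ℝ) : EReal) ≤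
       φ w + (((1 / 2 : ℝ) * ((w - x) ⬝ᵥ M.mulVec (w - x)) : ℝ) : EReal)

/-- Smallest eigenvalue of a symmetric matrix, via the Rayleigh quotient. -/
def lamMin {ι : Type*} [Fintype ι] (M : Matrix ι ι ℝ) : ℝ :=
  sInf {r | ∃ v : ι → ℝ, v ⬝ᵥ v = 1 ∧ r = v ⬝ᵥ M.mulVec v}

/-- Largest eigenvalue of a symmetric matrix, via the Rayleigh quotient. -/
def lamMax {ι : Type*} [Fintype ι] (M : Matrix ι ι ℝ) : ℝ :=
  sSup {r | ∃ v : ι → ℝ, v ⬝ᵥ v = 1 ∧ r = v ⬝ᵥ M.mulVec v}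

/-- Spectral (operator 2-) norm of a matrix. -/
def specNorm {ι κ : Type*} [Fintype ι] [Fintype κ] (A : Matrix ι κ ℝ) : ℝ :=
  sSup {r | ∃ v : κ → ℝ, v ⬝ᵥ v = 1 ∧ r = nrm (A.mulVec v)}

/-- A proper closed function is a Kurdyka–Łojasiewicz (KŁ) function: at every point of
its domain there are `η ∈ (0,∞]`, a neighborhood `U`, and a continuous concave
desingularizing function `φ` with `φ(0) = 0`, `φ ∈ C¹` and `φ′ > 0` on `(0,η)`, such
that the KŁ inequality `φ′(h(x) − h(x₀)) · dist(0, ∂h(x)) ≥ 1` holds on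
`U ∩ {h(x₀) < h < h(x₀) + η}`. -/
def KLFunction {ι : Type*} [Fintype ι] (h : (ι → ℝ) → EReal) : Prop :=
  ∀ x₀ : ι → ℝ, h x₀ ≠ ⊤ → h x₀ ≠ ⊥ →
    ∃ (η : EReal) (U : Set (ι → ℝ)) (φ φ' : ℝ → ℝ),
      0 < η ∧ U ∈ nhds x₀ ∧
      φ 0 = 0 ∧
      ContinuousOn φ {s : ℝ | 0 ≤ s ∧ (s : EReal) < η} ∧
      ConcaveOn ℝ {s : ℝ | 0 ≤ s ∧ (s : EReal) < η} φ ∧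
      (∀ s : ℝ, 0 < s → (s : EReal) < η → HasDerivAt φ (φ' s) s ∧ 0 < φ' s) ∧
      (∀ x ∈ U, h x₀ < h x → h x < h x₀ + η →
        ∀ v, SubgradAt h x v → 1 ≤ φ' ((h x - h x₀).toReal) * nrm v)

/-- A convex set containing `0` and a bounded family of vectors of `W` that stays
`τ`-away from every proper subspace contains a translate of a ball of `W` of uniform radius. -/
theorem exists_translated_ball_subset {F : Type*} [NormedAddCommGroup F] [InnerProductSpace ℝ F]
    [FiniteDimensional ℝ F] {τ : ℝ} (hτ : 0 < τ) (l : ℕ) :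
    ∃ ρ > 0, ∀ (W : Submodule ℝ F) (T C : Set F), T ⊆ W → (∀ v ∈ T, ‖v‖ ≤ 2) →
      (∀ V ≤ W, Module.finrank ℝ V < Module.finrank ℝ W → ∃ v ∈ T, ∀ w ∈ V, τ < ‖v - w‖) →
      Convex ℝ C → T ⊆ C → (0 : F) ∈ C → l ≤ Module.finrank ℝ W →
      ∃ V ≤ W, Module.finrank ℝ V = l ∧ ∃ c ∈ V, ∀ w ∈ V, ‖w‖ ≤ ρ → c + w ∈ C := by
  induction l with
  | zero =>
    refine ⟨1, one_pos, fun W T C _ _ _ _ _ h0 _ => ⟨⊥, bot_le, finrank_bot ℝ F, 0, zero_mem _, ?_⟩⟩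
    intro w hw _
    rw [Submodule.mem_bot] at hw
    simpa [hw] using h0
  | succ l ih =>
    obtain ⟨ρ, hρ, ih⟩ := ih
    have hK : 0 < 2 * (1 + 2 / τ) := by positivity
    refine ⟨min (τ / 4) (ρ / (2 * (1 + 2 / τ))), by positivity, ?_⟩
    intro W T C hTW hT hfar hC hTC h0 hl
    obtain ⟨V, hVW, hV, c, hcV, hc⟩ := ih W T C hTW hT hfar hC hTC h0 (by omega)
    obtain ⟨v, hvT, hv⟩ := hfar V hVW (by omega)
    have hvV : v ∉ V := fun h => by
      have := hv v h
      simp at this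
      linarith
    refine ⟨V ⊔ Submodule.span ℝ {v}, ?_, ?_, (1 / 2 : ℝ) • c + (1 / 4 : ℝ) • v, ?_, ?_⟩
    · refine sup_le hVW ?_
      rw [Submodule.span_singleton_le_iff_mem]
      exact hTW hvT
    · have h1 : V < V ⊔ Submodule.span ℝ {v} := by
        refine lt_of_le_of_ne le_sup_left fun h => hvV ?_
        rw [h]
        exact Submodule.mem_sup_right (Submodule.mem_span_singleton_self v)
      have h2 := Submodule.finrank_lt_finrank_of_lt h1
      have h3 := Submodule.finrank_add_le_finrank_add_finrank V (Submodule.span ℝ {v})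
      have h4 := finrank_span_le_card (R := ℝ) ({v} : Set F)
      simp at h4
      omega
    · exact add_mem (Submodule.mem_sup_left (V.smul_mem _ hcV))
        (Submodule.mem_sup_right (Submodule.smul_mem _ _ (Submodule.mem_span_singleton_self v)))
    · intro w hw hwn
      obtain ⟨u, hu, y, hy, rfl⟩ := Submodule.mem_sup.1 hw
      obtain ⟨s, rfl⟩ := Submodule.mem_span_singleton.1 hy
      have hs : |s| * τ ≤ ‖u + s • v‖ := by
        rcases eq_or_ne s 0 with rfl | hs
        · simp
        · have h1 := (hv (-(s⁻¹ • u)) (V.neg_mem (V.smul_mem _ hu))).le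
          have h2 : u + s • v = s • (v - -(s⁻¹ • u)) := by
            rw [sub_neg_eq_add, smul_add, smul_inv_smul₀ hs, add_comm]
          rw [h2, norm_smul, Real.norm_eq_abs]
          gcongr
      have hw1 := hwn.trans (min_le_left _ _)
      have hw2 := hwn.trans (min_le_right _ _)
      have hs4 : |s| ≤ 1 / 4 := by
        by_contra! h
        nlinarith
      have hun : ‖(2 : ℝ) • u‖ ≤ ρ := by
        have h1 : ‖u‖ ≤ ‖u + s • v‖ + |s| * 2 := by
          calc ‖u‖ = ‖(u + s • v) - s • v‖ := by simp
            _ ≤ ‖u + s • v‖ + ‖s • v‖ := norm_sub_le _ _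
            _ ≤ _ := by
              rw [norm_smul, Real.norm_eq_abs]
              have := hT v hvT
              gcongr
        have h2 : |s| ≤ ‖u + s • v‖ / τ := by rwa [le_div_iff₀ hτ]
        rw [le_div_iff₀ hK] at hw2
        rw [norm_smul, Real.norm_eq_abs, abs_two]
        calc 2 * ‖u‖ ≤ 2 * (‖u + s • v‖ + ‖u + s • v‖ / τ * 2) := by
              gcongr
              linarith
          _ = ‖u + s • v‖ * (2 * (1 + 2 / τ)) := by ring
          _ ≤ ρ := hw2
      have h1 := hc _ (V.smul_mem 2 hu) hun
      have h2 := hTC hvT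
      obtain ⟨hs1, hs2⟩ := abs_le.1 hs4
      have h3 := hC h2 h0 (a := 2 * (1 / 4 + s)) (b := 1 - 2 * (1 / 4 + s)) (by linarith)
        (by linarith) (by ring)
      have h4 := hC h1 h3 (a := 1 / 2) (b := 1 / 2) (by norm_num) (by norm_num) (by norm_num)
      convert h4 using 1
      module

/-- A bounded set of a finite-dimensional space has finite nets of uniformly bounded cardinality. -/
theorem exists_uniform_net_card {F : Type*} [NormedAddCommGroup F] [NormedSpace ℝ F]
    [FiniteDimensional ℝ F] (R : ℝ) {ρ : ℝ} (hρ : 0 < ρ) :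
    ∃ N : ℕ, 0 < N ∧ ∀ S : Set F, (∀ s ∈ S, ‖s‖ ≤ R) →
      ∃ E : Finset F, E.card ≤ N ∧ (∀ e ∈ E, e ∈ S) ∧ ∀ s ∈ S, ∃ e ∈ E, ‖s - e‖ ≤ ρ := by
  classical
  obtain ⟨D, -, hDfin, hD⟩ :=
    (isCompact_closedBall (0 : F) R).finite_cover_balls (half_pos hρ)
  refine ⟨hDfin.toFinset.card + 1, Nat.succ_pos _, fun S hS => ?_⟩
  set E₀ := hDfin.toFinset.filter fun d => ∃ s ∈ S, ‖s - d‖ < ρ / 2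
  have h : ∀ d, ∃ s, (∃ s ∈ S, ‖s - d‖ < ρ / 2) → s ∈ S ∧ ‖s - d‖ < ρ / 2 := fun d => by
    by_cases h : ∃ s ∈ S, ‖s - d‖ < ρ / 2
    · exact ⟨h.choose, fun _ => h.choose_spec⟩
    · exact ⟨0, fun h' => absurd h' h⟩
  choose e he using h
  refine ⟨E₀.image e, ?_, ?_, ?_⟩
  · exact (Finset.card_image_le.trans (Finset.card_filter_le _ _)).trans (Nat.le_succ _)
  · intro y hy
    obtain ⟨d, hd, rfl⟩ := Finset.mem_image.1 hy
    exact (he d (Finset.mem_filter.1 hd).2).1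
  · intro s hs
    have h1 := hD (show s ∈ Metric.closedBall 0 R by simpa using hS s hs)
    simp only [Set.mem_iUnion, Metric.mem_ball, exists_prop, dist_eq_norm] at h1
    obtain ⟨d, hd, hsd⟩ := h1
    refine ⟨e d, Finset.mem_image_of_mem _ (Finset.mem_filter.2 ⟨by simpa using hd, s, hs, hsd⟩),
      ?_⟩
    have h2 := (he d ⟨s, hs, hsd⟩).2
    calc ‖s - e d‖ = ‖(s - d) - (e d - d)‖ := by simp
      _ ≤ ‖s - d‖ + ‖e d - d‖ := norm_sub_le _ _
      _ ≤ ρ := by linarith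

section Descent

variable {F : Type*} [NormedAddCommGroup F] [InnerProductSpace ℝ F]

/-- A path `Z` each of whose vertices `Z i` has a direction `u i` in which all later vertices lie
lower by at least `γ i`, where `γ i` controls the length of the `i`-th step. -/
structure IsDirectedPath (Z u : ℕ → F) (γ : ℕ → ℝ) (K : ℝ) : Prop where
  pos : 0 < K
  nonneg : ∀ i, 0 ≤ γ i
  norm_le_one : ∀ i, ‖u i‖ ≤ 1
  step : ∀ i, ‖Z (i + 1) - Z i‖ ≤ K * γ i
  drop : ∀ i r, i < r → γ i ≤ inner ℝ (u i) (Z i - Z r)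

/-- The weight `γ a + ⋯ + γ (b - 1)` of an index interval. -/
def pathWeight (γ : ℕ → ℝ) (a b : ℕ) : ℝ := ∑ i ∈ Finset.Ico a b, γ i

/-- The convex hull of `0` and the directions with index in `[a, b)`. -/
def directionHull (u : ℕ → F) (a b : ℕ) : Set F := convexHull ℝ (insert 0 (u '' Set.Ico a b))

/-- All directions with index in `[a, b)` are `θ`-close to the subspace `W`. -/
def NearSubspace (u : ℕ → F) (W : Submodule ℝ F) (θ : ℝ) (a b : ℕ) : Prop :=
  ∀ k, a ≤ k → k < b → ∃ w ∈ W, ‖u k - w‖ ≤ θ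

theorem pathWeight_add (γ : ℕ → ℝ) {a b c : ℕ} (hab : a ≤ b) (hbc : b ≤ c) :
    pathWeight γ a b + pathWeight γ b c = pathWeight γ a c :=
  Finset.sum_Ico_consecutive γ hab hbc

theorem pathWeight_succ (γ : ℕ → ℝ) {a b : ℕ} (hab : a ≤ b) :
    pathWeight γ a (b + 1) = pathWeight γ a b + γ b :=
  Finset.sum_Ico_succ_top hab γ

theorem zero_mem_directionHull (u : ℕ → F) (a b : ℕ) : (0 : F) ∈ directionHull u a b :=
  subset_convexHull ℝ _ (Set.mem_insert _ _)

theorem mem_directionHull (u : ℕ → F) {a b k : ℕ} (hak : a ≤ k) (hkb : k < b) :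
    u k ∈ directionHull u a b :=
  subset_convexHull ℝ _ (Set.mem_insert_of_mem _ (Set.mem_image_of_mem u ⟨hak, hkb⟩))

theorem convex_directionHull (u : ℕ → F) (a b : ℕ) : Convex ℝ (directionHull u a b) :=
  convex_convexHull ℝ _

theorem directionHull_mono (u : ℕ → F) {a a' b b' : ℕ} (ha : a' ≤ a) (hb : b ≤ b') :
    directionHull u a b ⊆ directionHull u a' b' :=
  convexHull_mono (Set.insert_subset_insert (Set.image_mono (Set.Ico_subset_Ico ha hb)))

theorem directionHull_subset {u : ℕ → F} {a b : ℕ} {S : Set F} (hS : Convex ℝ S) (h0 : (0 : F) ∈ S)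
    (h : ∀ k, a ≤ k → k < b → u k ∈ S) : directionHull u a b ⊆ S := by
  refine convexHull_min (Set.insert_subset h0 ?_) hS
  rintro _ ⟨k, hk, rfl⟩
  exact h k hk.1 hk.2

theorem NearSubspace.mono {u : ℕ → F} {W : Submodule ℝ F} {θ θ' : ℝ} {a b a' b' : ℕ}
    (h : NearSubspace u W θ a b) (hθ : θ ≤ θ') (ha : a ≤ a') (hb : b' ≤ b) :
    NearSubspace u W θ' a' b' := fun k h1 h2 => by
  obtain ⟨w, hw, hk⟩ := h k (ha.trans h1) (h2.trans_le hb)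
  exact ⟨w, hw, hk.trans hθ⟩

theorem convex_setOf_exists_norm_sub_le {S : Set F} (hS : Convex ℝ S) (θ : ℝ) :
    Convex ℝ {v : F | ∃ w ∈ S, ‖w - v‖ ≤ θ} := by
  rintro v ⟨w, hw, hv⟩ v' ⟨w', hw', hv'⟩ s s' hs hs' h
  refine ⟨s • w + s' • w', hS hw hw' hs hs' h, ?_⟩
  calc ‖s • w + s' • w' - (s • v + s' • v')‖ = ‖s • (w - v) + s' • (w' - v')‖ := by
        congr 1
        module
    _ ≤ s * ‖w - v‖ + s' * ‖w' - v'‖ := by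
        refine (norm_add_le _ _).trans (le_of_eq ?_)
        rw [norm_smul, norm_smul, Real.norm_of_nonneg hs, Real.norm_of_nonneg hs']
    _ ≤ s * θ + s' * θ := by gcongr
    _ = θ := by rw [← add_mul, h, one_mul]

theorem NearSubspace.exists_norm_sub_le {u : ℕ → F} {W : Submodule ℝ F} {θ : ℝ} {a b : ℕ}
    (h : NearSubspace u W θ a b) (hθ : 0 ≤ θ) {v : F} (hv : v ∈ directionHull u a b) :
    ∃ w ∈ W, ‖v - w‖ ≤ θ := by
  have h1 := directionHull_subset (u := u) (a := a) (b := b)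
    (convex_setOf_exists_norm_sub_le W.convex θ)
    ⟨0, W.zero_mem, by simpa using hθ⟩ (fun k hk hk' => by
      obtain ⟨w, hw, hk⟩ := h k hk hk'
      exact ⟨w, hw, by rwa [norm_sub_rev]⟩) hv
  obtain ⟨w, hw, hvw⟩ := h1
  exact ⟨w, hw, by rwa [norm_sub_rev]⟩

namespace IsDirectedPath

variable {Z u : ℕ → F} {γ : ℕ → ℝ} {K : ℝ}

theorem weight_nonneg (h : IsDirectedPath Z u γ K) (a b : ℕ) : 0 ≤ pathWeight γ a b :=
  Finset.sum_nonneg fun i _ => h.nonneg i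

theorem norm_le_one_of_mem (h : IsDirectedPath Z u γ K) {a b : ℕ} {v : F}
    (hv : v ∈ directionHull u a b) : ‖v‖ ≤ 1 := by
  have := directionHull_subset (u := u) (a := a) (b := b) (convex_closedBall (0 : F) 1)
    (by simp) (fun k _ _ => by simpa using h.norm_le_one k) hv
  simpa using this

theorem norm_sub_le (h : IsDirectedPath Z u γ K) {a b : ℕ} (hab : a ≤ b) :
    ‖Z a - Z b‖ ≤ K * pathWeight γ a b := by
  induction b, hab using Nat.le_induction with
  | base => simp [pathWeight]
  | succ b hab ih =>
    rw [pathWeight_succ γ hab, mul_add]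
    calc ‖Z a - Z (b + 1)‖ = ‖(Z a - Z b) - (Z (b + 1) - Z b)‖ := by simp
      _ ≤ ‖Z a - Z b‖ + ‖Z (b + 1) - Z b‖ := _root_.norm_sub_le _ _
      _ ≤ _ := add_le_add ih (h.step b)

theorem weight_mono (h : IsDirectedPath Z u γ K) {a a' b b' : ℕ} (ha : a' ≤ a) (hb : b ≤ b') :
    pathWeight γ a b ≤ pathWeight γ a' b' :=
  Finset.sum_le_sum_of_subset_of_nonneg (Finset.Ico_subset_Ico ha hb) fun i _ _ => h.nonneg i

theorem norm_sub_le_of_mem (h : IsDirectedPath Z u γ K) {a b p q : ℕ} (hap : a ≤ p) (hpb : p ≤ b)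
    (haq : a ≤ q) (hqb : q ≤ b) : ‖Z p - Z q‖ ≤ K * pathWeight γ a b := by
  have hK := h.pos
  rcases le_total p q with hpq | hpq
  · exact (h.norm_sub_le hpq).trans (by gcongr; exact h.weight_mono hap hqb)
  · rw [norm_sub_rev]
    exact (h.norm_sub_le hpq).trans (by gcongr; exact h.weight_mono haq hpb)

theorem le_inner_direction (h : IsDirectedPath Z u γ K) {a b p k r : ℕ} (hap : a ≤ p) (hpb : p ≤ b)
    (hak : a ≤ k) (hkb : k ≤ b) (hkr : k < r) :
    γ k - K * pathWeight γ a b ≤ inner ℝ (u k) (Z p - Z r) := by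
  have h1 : Z p - Z r = (Z p - Z k) + (Z k - Z r) := by abel
  have h2 := abs_le.1 ((abs_real_inner_le_norm (u k) (Z p - Z k)).trans
    (mul_le_mul (h.norm_le_one k) (h.norm_sub_le_of_mem hap hpb hak hkb) (norm_nonneg _)
      one_pos.le))
  rw [h1, inner_add_right]
  linarith [h.drop k r hkr, h2.1]

theorem le_inner_of_mem (h : IsDirectedPath Z u γ K) {a b p r : ℕ} (hap : a ≤ p) (hpb : p ≤ b)
    (hbr : b + 1 ≤ r) {v : F} (hv : v ∈ directionHull u a (b + 1)) :
    -(K * pathWeight γ a b) ≤ inner ℝ v (Z p - Z r) := by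
  have hK := h.pos
  have hw := h.weight_nonneg a b
  refine directionHull_subset (S := {v | -(K * pathWeight γ a b) ≤ inner ℝ v (Z p - Z r)})
    ?_ ?_ ?_ hv
  · exact convex_halfSpace_ge ⟨fun x y => inner_add_left x y _, fun s x => by
      rw [inner_smul_left]; rfl⟩ _
  · simp only [Set.mem_ofPred_eq, inner_zero_left]
    linarith [mul_nonneg hK.le hw]
  · intro k hk hk'
    have := h.le_inner_direction hap hpb hk (Nat.lt_succ_iff.1 hk') (lt_of_lt_of_le hk' hbr)
    exact le_trans (by linarith [h.nonneg k]) this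

theorem exists_gain_and_ball [FiniteDimensional ℝ F] (h : IsDirectedPath Z u γ K) {i : ℕ}
    {c θ' : ℝ} (hθ'0 : 0 < θ')
    (hi : ∀ W : Submodule ℝ F, Module.finrank ℝ W ≤ i → ∀ a b, a ≤ b → NearSubspace u W θ' a b →
      ∃ p, a ≤ p ∧ p ≤ b ∧ ∃ v ∈ directionHull u a b, ∀ r, b ≤ r →
        c * pathWeight γ a b ≤ inner ℝ v (Z p - Z r))
    {t : ℝ} (ht : 0 < t) (ht4 : t ≤ 1 / 4) (htc : t * (2 * (2 * K + 1)) ≤ c) :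
    ∃ ρ > 0, ∀ θ, 0 < θ → θ ≤ 1 → θ ≤ θ' / 2 →
      ∀ W : Submodule ℝ F, Module.finrank ℝ W = i + 1 → ∀ a b, a ≤ b →
      NearSubspace u W θ a (b + 1) →
      (∃ W' ≤ W, Module.finrank ℝ W' ≤ i ∧ NearSubspace u W' θ' a b) →
      (¬ ∃ W' ≤ W, Module.finrank ℝ W' ≤ i ∧ NearSubspace u W' θ' a (b + 1)) →
      ∃ p, a ≤ p ∧ p ≤ b ∧ ∃ y ∈ W, ‖y‖ ≤ 3 ∧ ∀ w ∈ W, ‖y - w‖ ≤ ρ →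
        ∃ v ∈ directionHull u a (b + 1), ‖v - w‖ ≤ θ ∧ ∀ r, b + 1 ≤ r →
          t * pathWeight γ a (b + 1) ≤ inner ℝ v (Z p - Z r) := by
  obtain ⟨ρ, hρ, hball⟩ := exists_translated_ball_subset (F := F) (half_pos hθ'0) (i + 1)
  refine ⟨t * ρ, by positivity, ?_⟩
  intro θ hθ hθ1 hθθ' W hW a b hab hnear ⟨W', hW'W, hW'i, hW'⟩ hnot
  obtain ⟨p, hap, hpb, v₀, hv₀, hdrop⟩ := hi W' hW'i a b hab hW'
  have hbdd : ∀ {v w : F}, v ∈ directionHull u a (b + 1) → ‖v - w‖ ≤ θ → ‖w‖ ≤ 2 := by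
    intro v w hv hw
    calc ‖w‖ = ‖v - (v - w)‖ := by simp
      _ ≤ ‖v‖ + ‖v - w‖ := _root_.norm_sub_le _ _
      _ ≤ 2 := by linarith [h.norm_le_one_of_mem hv]
  have hv₀' := directionHull_mono u le_rfl (Nat.le_succ b) hv₀
  obtain ⟨w₀, hw₀W, hw₀⟩ := hnear.exists_norm_sub_le hθ.le hv₀'
  obtain ⟨wb, hwbW, hwb⟩ := hnear b hab (Nat.lt_succ_self b)
  have hub := mem_directionHull u hab (Nat.lt_succ_self b)
  obtain ⟨V, hVW, hV, y₁, hy₁, hy⟩ := hball W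
    {w | w ∈ W ∧ ∃ k, a ≤ k ∧ k < b + 1 ∧ ‖u k - w‖ ≤ θ}
    {w | ∃ v ∈ directionHull u a (b + 1), ‖v - w‖ ≤ θ} (fun w hw => hw.1)
    (fun w ⟨_, k, hk, hk', hkw⟩ => hbdd (mem_directionHull u hk hk') hkw)
    (fun V hVW hV => by
      by_contra! hcon
      refine hnot ⟨V, hVW, by omega, fun k hk hk' => ?_⟩
      obtain ⟨w, hw, hkw⟩ := hnear k hk hk'
      obtain ⟨w', hw', hww'⟩ := hcon w ⟨hw, k, hk, hk', hkw⟩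
      refine ⟨w', hw', ?_⟩
      calc ‖u k - w'‖ = ‖(u k - w) + (w - w')‖ := by simp
        _ ≤ ‖u k - w‖ + ‖w - w'‖ := norm_add_le _ _
        _ ≤ θ' := by linarith)
    (convex_setOf_exists_norm_sub_le (convex_directionHull u a (b + 1)) θ)
    (fun w ⟨_, k, hk, hk', hkw⟩ => ⟨u k, mem_directionHull u hk hk', hkw⟩)
    ⟨0, zero_mem_directionHull u a (b + 1), by simpa using hθ.le⟩ hW.ge
  obtain rfl : V = W := Submodule.eq_of_le_of_finrank_eq hVW (hV.trans hW.symm)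
  have hy₁2 : ‖y₁‖ ≤ 2 := by
    obtain ⟨v, hv, hvw⟩ := hy 0 V.zero_mem (by simpa using hρ.le)
    simpa using hbdd hv hvw
  refine ⟨p, hap, hpb, (1 / 2 : ℝ) • w₀ + t • wb + t • y₁,
    V.add_mem (V.add_mem (V.smul_mem _ hw₀W) (V.smul_mem _ hwbW)) (V.smul_mem _ hy₁), ?_, ?_⟩
  · calc ‖(1 / 2 : ℝ) • w₀ + t • wb + t • y₁‖ ≤ 1 / 2 * ‖w₀‖ + t * ‖wb‖ + t * ‖y₁‖ := by
          refine (norm_add₃_le).trans (le_of_eq ?_)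
          simp only [norm_smul, Real.norm_of_nonneg ht.le]
          norm_num
      _ ≤ 1 / 2 * 2 + 1 / 4 * 2 + 1 / 4 * 2 := by
          gcongr
          · exact hbdd hv₀' hw₀
          · exact hbdd hub hwb
      _ ≤ 3 := by norm_num
  · intro w hw hwy
    obtain ⟨v₁, hv₁, hv₁'⟩ := hy (t⁻¹ • (w - ((1 / 2 : ℝ) • w₀ + t • wb + t • y₁)))
      (V.smul_mem _ (V.sub_mem hw (V.add_mem (V.add_mem (V.smul_mem _ hw₀W)
        (V.smul_mem _ hwbW)) (V.smul_mem _ hy₁)))) (by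
        rw [norm_smul, norm_inv, Real.norm_of_nonneg ht.le, inv_mul_le_iff₀ ht, norm_sub_rev]
        exact hwy)
    set w' := t⁻¹ • (w - ((1 / 2 : ℝ) • w₀ + t • wb + t • y₁)) with hw'
    have hww' : w = (1 / 2 : ℝ) • w₀ + t • wb + t • (y₁ + w') := by
      rw [smul_add, hw', smul_inv_smul₀ ht.ne']
      abel
    refine ⟨(1 / 2 : ℝ) • v₀ + t • u b + t • v₁, ?_, ?_, ?_⟩
    · have hC := convex_directionHull u a (b + 1)
      have h0 := zero_mem_directionHull u a (b + 1)
      have h1 := hC hub hv₁ (a := 1 / 2) (b := 1 / 2) (by norm_num) (by norm_num) (by norm_num)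
      have h2 := hC h1 h0 (a := 4 * t) (b := 1 - 4 * t) (by linarith) (by linarith) (by ring)
      have h3 := hC hv₀' h2 (a := 1 / 2) (b := 1 / 2) (by norm_num) (by norm_num) (by norm_num)
      convert h3 using 1
      module
    · calc ‖(1 / 2 : ℝ) • v₀ + t • u b + t • v₁ - w‖
          = ‖(1 / 2 : ℝ) • (v₀ - w₀) + t • (u b - wb) + t • (v₁ - (y₁ + w'))‖ := by
            rw [hww']
            congr 1
            module
        _ ≤ 1 / 2 * ‖v₀ - w₀‖ + t * ‖u b - wb‖ + t * ‖v₁ - (y₁ + w')‖ := by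
            refine (norm_add₃_le).trans (le_of_eq ?_)
            simp only [norm_smul, Real.norm_of_nonneg ht.le]
            norm_num
        _ ≤ 1 / 2 * θ + 1 / 4 * θ + 1 / 4 * θ := by gcongr
        _ = θ := by ring
    · intro r hr
      have h0 := hdrop r (by omega)
      have h1 := h.le_inner_direction hap hpb hab le_rfl (lt_of_lt_of_le (Nat.lt_succ_self b) hr)
      have h2 := h.le_inner_of_mem hap hpb hr hv₁
      have hΓ := h.weight_nonneg a b
      rw [pathWeight_succ γ hab]
      simp only [inner_add_left, inner_smul_left, RCLike.conj_to_real]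
      nlinarith [mul_le_mul_of_nonneg_right htc hΓ, mul_le_mul_of_nonneg_left h1 ht.le,
        mul_le_mul_of_nonneg_left h2 ht.le]

theorem exists_decomposition (h : IsDirectedPath Z u γ K) {t θ : ℝ} (ht : 0 ≤ t)
    (E : Finset F) (P : ℕ → ℕ → Prop) (hP : ∀ a, P a a) (a₀ B : ℕ)
    (hpiece : ∀ a b, a₀ ≤ a → a ≤ b → b + 1 ≤ B → P a b → ¬ P a (b + 1) →
      ∃ e ∈ E, ∃ p, a ≤ p ∧ p ≤ b ∧ ∃ v ∈ directionHull u a (b + 1), ‖v - e‖ ≤ θ ∧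
        ∀ r, b + 1 ≤ r → t * pathWeight γ a (b + 1) ≤ inner ℝ v (Z p - Z r)) :
    ∀ l a, a₀ ≤ a → a + l = B →
      ∃ a', a ≤ a' ∧ a' ≤ B ∧ P a' B ∧ ∃ g : F → ℝ, (∀ e, 0 ≤ g e) ∧
        t * pathWeight γ a a' ≤ ∑ e ∈ E, g e ∧
        ∀ e ∈ E, 0 < g e → ∃ p, a ≤ p ∧ p ≤ B ∧ ∃ v ∈ directionHull u a B, ‖v - e‖ ≤ θ ∧
          ∀ r, B ≤ r → g e - 2 * θ * (K * pathWeight γ p B) ≤ inner ℝ v (Z p - Z r) := by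
  classical
  intro l
  induction l using Nat.strong_induction_on with
  | _ l ih =>
  intro a ha haB
  by_cases hPB : P a B
  · exact ⟨a, le_rfl, by omega, hPB, 0, fun _ => le_rfl, by simp [pathWeight],
      fun e _ he => absurd he (lt_irrefl _)⟩
  have hex : ∃ b, a ≤ b ∧ b + 1 ≤ B ∧ P a b ∧ ¬ P a (b + 1) := by
    by_contra! hcon
    have : ∀ j, a + j ≤ B → P a (a + j) := by
      intro j
      induction j with
      | zero => exact fun _ => hP a
      | succ j ihj => exact fun hj => hcon (a + j) (by omega) hj (ihj (by omega))
    exact hPB (haB ▸ this l haB.le)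
  obtain ⟨b, hab, hbB, hPb, hPb'⟩ := hex
  obtain ⟨e₀, he₀, p₀, hap₀, hp₀b, v₀, hv₀, hv₀e, hgain⟩ := hpiece a b ha hab hbB hPb hPb'
  obtain ⟨a', hba', ha'B, hPa', g, hg, hsum, hcol⟩ :=
    ih (B - (b + 1)) (by omega) (b + 1) (by omega) (by omega)
  have hK := h.pos
  have hθ : 0 ≤ θ := (norm_nonneg _).trans hv₀e
  have hw := h.weight_nonneg a (b + 1)
  have hv₀' := directionHull_mono u le_rfl hbB hv₀
  refine ⟨a', by omega, ha'B, hPa', fun e => g e + if e = e₀ then t * pathWeight γ a (b + 1) else 0,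
    fun e => ?_, ?_, fun e he hpos => ?_⟩
  · have := hg e
    dsimp only
    split_ifs <;> positivity
  · rw [Finset.sum_add_distrib, Finset.sum_ite_eq', if_pos he₀,
      ← pathWeight_add γ (show a ≤ b + 1 by omega) hba', mul_add]
    linarith
  · by_cases hee : e = e₀
    · subst hee
      simp only [if_true]
      rcases (hg e).eq_or_lt with h0 | h0
      · refine ⟨p₀, hap₀, by omega, v₀, hv₀', hv₀e, fun r hr => ?_⟩
        have h1 := hgain r (by omega)
        have h2 : 0 ≤ 2 * θ * (K * pathWeight γ p₀ B) :=
          mul_nonneg (by positivity) (mul_nonneg hK.le (h.weight_nonneg _ _))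
        linarith
      · obtain ⟨p, hbp, hpB, v, hv, hve, hvr⟩ := hcol e he h0
        refine ⟨p₀, hap₀, by omega, v, directionHull_mono u (by omega) le_rfl hv, hve,
          fun r hr => ?_⟩
        have h1 := hvr r hr
        have h2 := hgain p hbp
        have h3 : ‖v₀ - v‖ ≤ 2 * θ := by
          calc ‖v₀ - v‖ = ‖(v₀ - e) - (v - e)‖ := by simp
            _ ≤ ‖v₀ - e‖ + ‖v - e‖ := _root_.norm_sub_le _ _
            _ ≤ 2 * θ := by linarith
        have h4 : inner ℝ (v₀ - v) (Z p₀ - Z p) ≤ 2 * θ * (K * pathWeight γ p₀ p) :=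
          (real_inner_le_norm _ _).trans
            (mul_le_mul h3 (h.norm_sub_le (by omega)) (norm_nonneg _) (by positivity))
        rw [inner_sub_left] at h4
        have h5 : Z p₀ - Z r = (Z p₀ - Z p) + (Z p - Z r) := by abel
        rw [h5, inner_add_right, ← pathWeight_add γ (show p₀ ≤ p by omega) hpB]
        linarith
    · simp only [if_neg hee, add_zero] at hpos ⊢
      obtain ⟨p, hbp, hpB, v, hv, hve, hvr⟩ := hcol e he hpos
      exact ⟨p, by omega, hpB, v, directionHull_mono u (by omega) le_rfl hv, hve, hvr⟩

theorem exists_uniform_drop [FiniteDimensional ℝ F] (h : IsDirectedPath Z u γ K) (i : ℕ) :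
    ∃ c > 0, ∃ θ > 0, ∀ W : Submodule ℝ F, Module.finrank ℝ W ≤ i → ∀ a b, a ≤ b →
      NearSubspace u W θ a b → ∃ p, a ≤ p ∧ p ≤ b ∧ ∃ v ∈ directionHull u a b, ∀ r, b ≤ r →
        c * pathWeight γ a b ≤ inner ℝ v (Z p - Z r) := by
  have hK := h.pos
  induction i with
  | zero =>
    refine ⟨1, one_pos, 1 / (2 * K), by positivity, fun W hW a b hab hnear => ?_⟩
    have hW : W = ⊥ := Submodule.finrank_eq_zero.1 (Nat.le_zero.1 hW)
    have hγ : ∀ k ∈ Finset.Ico a b, γ k = 0 := by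
      intro k hk
      rw [Finset.mem_Ico] at hk
      obtain ⟨w, hw, hkw⟩ := hnear k hk.1 hk.2
      rw [hW, Submodule.mem_bot] at hw
      rw [hw, sub_zero] at hkw
      have h1 := h.drop k (k + 1) (Nat.lt_succ_self k)
      have h2 := h.step k
      rw [norm_sub_rev] at h2
      have h3 := (real_inner_le_norm (u k) (Z k - Z (k + 1))).trans
        (mul_le_mul hkw h2 (norm_nonneg _) (by positivity))
      have h4 : 1 / (2 * K) * (K * γ k) = γ k / 2 := by field_simp
      linarith [h.nonneg k]
    refine ⟨a, le_rfl, hab, 0, zero_mem_directionHull u a b, fun r _ => ?_⟩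
    simp [pathWeight, Finset.sum_eq_zero hγ]
  | succ i ih =>
    obtain ⟨c, hc, θ', hθ', hi⟩ := ih
    set t := min (1 / 4) (c / (2 * (2 * K + 1))) with ht_def
    have ht : 0 < t := by positivity
    have htc : t * (2 * (2 * K + 1)) ≤ c := by
      rw [← le_div_iff₀ (by positivity)]
      exact min_le_right _ _
    obtain ⟨ρ, hρ, hpiece⟩ := h.exists_gain_and_ball hθ' hi ht (min_le_left _ _) htc
    obtain ⟨N, hN, hnet⟩ := exists_uniform_net_card (F := F) 3 hρ
    have hN' : (0 : ℝ) < N := by exact_mod_cast hN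
    set θ := min (min 1 (θ' / 2)) (t / (16 * N * K)) with hθ_def
    have hθ : 0 < θ := by positivity
    have hθ1 : θ ≤ 1 := (min_le_left _ _).trans (min_le_left _ _)
    have hθ2 : θ ≤ θ' / 2 := (min_le_left _ _).trans (min_le_right _ _)
    have hθ3 : θ * K ≤ t / (16 * N) := by
      calc θ * K ≤ t / (16 * N * K) * K := by
            gcongr
            exact min_le_right _ _
        _ = t / (16 * N) := by field_simp
    refine ⟨min (c / 2) (t / (8 * N)), by positivity, θ, hθ, fun W hW a b hab hnear => ?_⟩
    have hL := h.weight_nonneg a b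
    have hc1 : min (c / 2) (t / (8 * N)) * pathWeight γ a b ≤ c / 2 * pathWeight γ a b := by
      gcongr
      exact min_le_left _ _
    have hc2 : min (c / 2) (t / (8 * N)) * pathWeight γ a b ≤ t / (8 * N) * pathWeight γ a b := by
      gcongr
      exact min_le_right _ _
    rcases Nat.le_succ_iff.1 hW with hWi | hWi
    · obtain ⟨p, hap, hpb, v, hv, hr⟩ := hi W hWi a b hab
        (hnear.mono (by linarith) le_rfl le_rfl)
      refine ⟨p, hap, hpb, v, hv, fun r hbr => ?_⟩
      have := hr r hbr
      nlinarith [mul_nonneg hc.le hL]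
    rcases hL.eq_or_lt with hL0 | hLpos
    · exact ⟨a, le_rfl, hab, 0, zero_mem_directionHull u a b, fun r _ => by simp [← hL0]⟩
    obtain ⟨E, hE, hEW, hcover⟩ := hnet {w | w ∈ W ∧ ‖w‖ ≤ 3} fun w hw => hw.2
    obtain ⟨a', haa', ha'b, ⟨W', -, hW'i, hW'⟩, g, hg, hsum, hcol⟩ :=
      h.exists_decomposition ht.le E
      (fun a b => ∃ W' ≤ W, Module.finrank ℝ W' ≤ i ∧ NearSubspace u W' θ' a b)
      (fun a => ⟨⊥, bot_le, by simp, fun k hk hk' => absurd hk' (not_lt.2 hk)⟩) a b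
      (fun a₁ b₁ ha₁ hab₁ hb₁ hP hP' => by
        obtain ⟨p, hp, hp', y, hyW, hy3, hy⟩ := hpiece θ hθ hθ1 hθ2 W hWi a₁ b₁ hab₁
          (hnear.mono le_rfl ha₁ hb₁) hP hP'
        obtain ⟨e, heE, he⟩ := hcover y ⟨hyW, hy3⟩
        obtain ⟨v, hv, hve, hr⟩ := hy e (hEW e heE).1 he
        exact ⟨e, heE, p, hp, hp', v, hv, hve, hr⟩) (b - a) a le_rfl (by omega)
    have hadd := pathWeight_add γ haa' ha'b
    rcases le_total (pathWeight γ a b / 2) (pathWeight γ a' b) with hhalf | hhalf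
    · obtain ⟨p, hap, hpb, v, hv, hr⟩ := hi W' hW'i a' b ha'b hW'
      refine ⟨p, by omega, hpb, v, directionHull_mono u haa' le_rfl hv, fun r hbr => ?_⟩
      have := hr r hbr
      nlinarith
    · have hex : ∃ e ∈ E, t * pathWeight γ a b / (4 * N) < g e := by
        by_contra! hcon
        have h1 := Finset.sum_le_card_nsmul E g _ hcon
        rw [nsmul_eq_mul] at h1
        have h2 : (E.card : ℝ) ≤ N := by exact_mod_cast hE
        have h3 : (E.card : ℝ) * (t * pathWeight γ a b / (4 * N)) ≤
            N * (t * pathWeight γ a b / (4 * N)) := by gcongr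
        have h4 : N * (t * pathWeight γ a b / (4 * N)) = t * pathWeight γ a b / 4 := by
          field_simp
        nlinarith [mul_pos ht hLpos]
      obtain ⟨e, heE, hge⟩ := hex
      obtain ⟨p, hap, hpb, v, hv, -, hr⟩ := hcol e heE (lt_of_le_of_lt (by positivity) hge)
      refine ⟨p, hap, hpb, v, hv, fun r hbr => ?_⟩
      have h1 := hr r hbr
      have h2 : 2 * θ * (K * pathWeight γ p b) ≤ 2 * (t / (16 * N)) * pathWeight γ a b := by
        calc 2 * θ * (K * pathWeight γ p b) = 2 * (θ * K) * pathWeight γ p b := by ring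
          _ ≤ 2 * (t / (16 * N)) * pathWeight γ a b := by
            gcongr
            · exact h.weight_nonneg _ _
            · exact h.weight_mono hap le_rfl
      have h3 : t * pathWeight γ a b / (4 * N) - 2 * (t / (16 * N)) * pathWeight γ a b =
          t / (8 * N) * pathWeight γ a b := by
        field_simp
        ring
      linarith

/-- A bounded directed path has finite weight. -/
theorem exists_weight_le [FiniteDimensional ℝ F] (h : IsDirectedPath Z u γ K) {R : ℝ}
    (hR : ∀ i j, ‖Z i - Z j‖ ≤ R) : ∃ C, ∀ N, pathWeight γ 0 N ≤ C := by
  obtain ⟨c, hc, θ, hθ, hdrop⟩ := h.exists_uniform_drop (Module.finrank ℝ F)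
  refine ⟨R / c, fun N => ?_⟩
  obtain ⟨p, -, -, v, hv, hr⟩ := hdrop ⊤ (finrank_top ℝ F).le 0 N (Nat.zero_le N)
    (fun k _ _ => ⟨u k, Submodule.mem_top, by simpa using hθ.le⟩)
  rw [le_div_iff₀ hc, mul_comm]
  calc c * pathWeight γ 0 N ≤ inner ℝ v (Z p - Z N) := hr N le_rfl
    _ ≤ ‖v‖ * ‖Z p - Z N‖ := real_inner_le_norm _ _
    _ ≤ 1 * R := mul_le_mul (h.norm_le_one_of_mem hv) (hR p N) (norm_nonneg _) one_pos.le
    _ = R := one_mul R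

end IsDirectedPath

end Descent

theorem pathWeight_mono {e : ℕ → ℝ} (he : ∀ k, 0 ≤ e k) {a a' b b' : ℕ} (ha : a' ≤ a)
    (hb : b ≤ b') : pathWeight e a b ≤ pathWeight e a' b' :=
  Finset.sum_le_sum_of_subset_of_nonneg (Finset.Ico_subset_Ico ha hb) fun i _ _ => he i

theorem le_pathWeight {e : ℕ → ℝ} (he : ∀ k, 0 ≤ e k) {a b i : ℕ} (ha : a ≤ i) (hb : i < b) :
    e i ≤ pathWeight e a b :=
  Finset.single_le_sum (fun i _ => he i) (Finset.mem_Ico.2 ⟨ha, hb⟩)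

theorem summable_of_pathWeight_le {e : ℕ → ℝ} (he : ∀ k, 0 ≤ e k) (m : ℕ) {C : ℝ}
    (h : ∀ M, m ≤ M → pathWeight e (m + 1) (M + 1) ≤ C) : Summable e := by
  refine (summable_nat_add_iff (m + 1)).1 (summable_of_sum_range_le (c := C) (fun k => he _)
    fun k => ?_)
  have h1 := h (m + k) (Nat.le_add_right m k)
  rw [pathWeight, Finset.sum_Ico_eq_sum_range] at h1
  convert h1 using 2
  · congr 1
    omega
  · rw [add_comm]

/-- Whenever every index in `[m, M)` has a much smaller term shortly after it, the tail sum is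
controlled by the initial term. -/
theorem pathWeight_le_of_forall_exists_le {e : ℕ → ℝ} (he : ∀ k, 0 ≤ e k) {T : ℕ} {D : ℝ}
    (hD : 0 ≤ D)
    {Bad : ℕ → Prop} (hsmall : ∀ k, Bad k → ∃ i, k < i ∧ i ≤ k + T ∧ e i ≤ e k / 4)
    (hsum : ∀ k, Bad k → pathWeight e (k + 1) (k + T + 1) ≤ D * e k) (l : ℕ) :
    ∀ m M, m + l = M → (∀ k, m ≤ k → k < M → Bad k) →
      pathWeight e (m + 1) (M + 1) ≤ 2 * D * e m := by
  induction l using Nat.strong_induction_on with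
  | _ l ih =>
  intro m M hM hbad
  have hem := he m
  rcases Nat.eq_zero_or_pos l with rfl | hl
  · obtain rfl : m = M := by omega
    simp only [pathWeight, Finset.Ico_self, Finset.sum_empty]
    positivity
  have hm := hbad m le_rfl (by omega)
  obtain ⟨i, hmi, hiT, hi⟩ := hsmall m hm
  have h1 := hsum m hm
  have hDe := mul_nonneg hD hem
  rcases le_total M i with h | h
  · have := pathWeight_mono he (le_refl (m + 1)) (show M + 1 ≤ m + T + 1 by omega)
    linarith
  · have h2 := ih (M - i) (by omega) i M (by omega) fun k hk hk' => hbad k (by omega) hk'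
    have h3 := pathWeight_add e (show m + 1 ≤ i + 1 by omega) (show i + 1 ≤ M + 1 by omega)
    have h4 := pathWeight_mono he (le_refl (m + 1)) (show i + 1 ≤ m + T + 1 by omega)
    nlinarith [mul_le_mul_of_nonneg_left hi hD]

/-- Finite length of a bounded sequence along which the linear functionals `p k` decrease by the
accumulated squared step lengths. -/
theorem summable_of_inner_le {F : Type*} [NormedAddCommGroup F] [InnerProductSpace ℝ F]
    [FiniteDimensional ℝ F] {z p : ℕ → F} {e : ℕ → ℝ} {a C R : ℝ} (ha : 0 < a) (hC : 0 < C)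
    (he : ∀ k, 0 ≤ e k) (hz : ∀ k, ‖z (k + 1) - z k‖ ≤ e (k + 1)) (hp : ∀ k, ‖p k‖ ≤ C * e k)
    (hpz : ∀ k j, k < j → inner ℝ (p k) (z j - z k) ≤
      -(a * pathWeight (fun i => e i ^ 2) (k + 1) (j + 1)) + C * e k ^ 2)
    (hR : ∀ i j, ‖z i - z j‖ ≤ R) : Summable e := by
  have he2 : ∀ k, 0 ≤ (fun i => e i ^ 2) k := fun k => sq_nonneg _
  set K₀ := 2 * C / a with hK₀_def
  have hK₀ : 0 < K₀ := by positivity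
  have haK₀ : a * K₀ = 2 * C := by
    rw [hK₀_def]
    field_simp
  obtain ⟨T, hT⟩ := exists_nat_ge (16 * K₀ + 1)
  have hT1 : 1 ≤ T := by
    have : (1 : ℝ) ≤ T := by linarith
    exact_mod_cast this
  set S : ℕ → ℝ := fun k => pathWeight (fun i => e i ^ 2) (k + 1) (k + T + 1) with hS_def
  have hS : ∀ k, 0 ≤ S k := fun k => Finset.sum_nonneg fun i _ => he2 i
  have heS : ∀ k i, k < i → i ≤ k + T → e i ^ 2 ≤ S k := fun k i h1 h2 =>
    le_pathWeight he2 (show k + 1 ≤ i from h1) (Nat.lt_succ_of_le h2)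
  have hcard : ∀ k, (Finset.Ico (k + 1) (k + T + 1)).card = T := fun k => by
    rw [Nat.card_Ico]
    omega
  have hsum_le : ∀ k s, (∀ i, k < i → i ≤ k + T → e i ≤ s) →
      pathWeight e (k + 1) (k + T + 1) ≤ T * s := fun k s hs => by
    have := Finset.sum_le_card_nsmul (Finset.Ico (k + 1) (k + T + 1)) e s fun i hi => by
      rw [Finset.mem_Ico] at hi
      exact hs i hi.1 (Nat.lt_succ_iff.1 hi.2)
    rwa [hcard, nsmul_eq_mul] at this
  set D := T * (1 + K₀)
  have hD : 0 ≤ D := by positivity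
  have hrun := pathWeight_le_of_forall_exists_le he (T := T) hD
    (Bad := fun k => S k < K₀ * e k ^ 2)
    (fun k hk => by
      by_contra! hcon
      have h1 := Finset.card_nsmul_le_sum (Finset.Ico (k + 1) (k + T + 1)) (fun i => e i ^ 2)
        ((e k / 4) ^ 2) fun i hi => by
          rw [Finset.mem_Ico] at hi
          have := hcon i hi.1 (Nat.lt_succ_iff.1 hi.2)
          have := he k
          gcongr
      rw [hcard, nsmul_eq_mul] at h1
      change _ ≤ S k at h1
      nlinarith [sq_nonneg (e k)])
    (fun k hk => by
      have := hsum_le k ((1 + K₀) * e k) fun i h1 h2 => by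
        have h3 := heS k i h1 h2
        have h4 : 0 ≤ (1 + K₀) * e k := mul_nonneg (by positivity) (he k)
        refine abs_le_of_sq_le_sq' ?_ h4 |>.2
        nlinarith [sq_nonneg (e k), mul_nonneg hK₀.le (sq_nonneg (e k)), sq_nonneg (K₀ * e k)]
      rwa [← mul_assoc] at this)
  by_cases hgood : ∀ m, ∃ k, m ≤ k ∧ K₀ * e k ^ 2 ≤ S k
  swap
  · push Not at hgood
    obtain ⟨m, hm⟩ := hgood
    exact summable_of_pathWeight_le he m fun M hM =>
      hrun (M - m) m M (by omega) fun k hk _ => hm k hk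
  have hnext : ∀ m, ∃ k, m ≤ k ∧ K₀ * e k ^ 2 ≤ S k ∧ ∀ j, m ≤ j → j < k → S j < K₀ * e j ^ 2 := by
    intro m
    classical
    refine ⟨Nat.find (hgood m), (Nat.find_spec (hgood m)).1, (Nat.find_spec (hgood m)).2, ?_⟩
    intro j hj hj'
    by_contra! hcon
    exact Nat.find_min (hgood m) hj' ⟨hj, hcon⟩
  choose next hnext1 hnext2 hnext3 using hnext
  set κ : ℕ → ℕ := fun i => Nat.rec (next 0) (fun _ k => next (k + T)) i
  have hκ : ∀ i, κ (i + 1) = next (κ i + T) := fun i => rfl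
  have hκgood : ∀ i, K₀ * e (κ i) ^ 2 ≤ S (κ i) := fun i => by
    cases i with
    | zero => exact hnext2 0
    | succ i => exact hnext2 _
  have hκstep : ∀ i, κ i + T ≤ κ (i + 1) := fun i => hnext1 _
  have hκlt : ∀ i r, i < r → κ i + T ≤ κ r := fun i r hir => by
    induction r, hir using Nat.le_induction with
    | base => exact hκstep i
    | succ r _ ih => exact (ih.trans (Nat.le_add_right _ _)).trans (hκstep r)
  have hκge : ∀ i, i ≤ κ i := fun i => by
    induction i with
    | zero => exact Nat.zero_le _
    | succ i ih =>
      have := hκstep i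
      omega
  set G : ℕ → ℝ := fun i => √(S (κ i))
  have hG : ∀ i, 0 ≤ G i := fun i => Real.sqrt_nonneg _
  have hGsq : ∀ i, G i ^ 2 = S (κ i) := fun i => Real.sq_sqrt (hS _)
  have hwin : ∀ i j, κ i < j → j ≤ κ i + T → e j ≤ G i := fun i j h1 h2 =>
    Real.le_sqrt_of_sq_le (heS _ _ h1 h2)
  have hblock : ∀ i, pathWeight e (κ i + 1) (κ (i + 1) + 1) ≤ (T + 2 * D) * G i := fun i => by
    have h1 := hsum_le (κ i) (G i) (hwin i)
    have h2 := hrun (κ (i + 1) - (κ i + T)) (κ i + T) (κ (i + 1)) (by have := hκstep i; omega)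
      (hnext3 _)
    have h3 := hwin i (κ i + T) (by omega) le_rfl
    have h4 := pathWeight_add e (show κ i + 1 ≤ κ i + T + 1 by omega)
      (show κ i + T + 1 ≤ κ (i + 1) + 1 by have := hκstep i; omega)
    nlinarith [mul_le_mul_of_nonneg_left h3 hD]
  set Q := C * (1 + 1 / K₀)
  have hQ : 0 < Q := by positivity
  have hpQ : ∀ i, ‖p (κ i)‖ ≤ Q * G i := fun i => by
    have h1 : e (κ i) ≤ (1 + 1 / K₀) * G i := by
      refine abs_le_of_sq_le_sq' ?_ (mul_nonneg (by positivity) (hG i)) |>.2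
      have h2 : e (κ i) ^ 2 ≤ 1 / K₀ * G i ^ 2 := by
        rw [hGsq, one_div, ← div_eq_inv_mul, le_div_iff₀ hK₀, mul_comm]
        exact hκgood i
      have h3 : 0 < 1 / K₀ := by positivity
      nlinarith [sq_nonneg (G i), mul_nonneg h3.le (sq_nonneg (G i)), sq_nonneg (1 / K₀ * G i)]
    calc ‖p (κ i)‖ ≤ C * e (κ i) := hp _
      _ ≤ C * ((1 + 1 / K₀) * G i) := by gcongr
      _ = Q * G i := by ring
  have hlen : ∀ j k, k ≤ j → ‖z j - z k‖ ≤ pathWeight e (k + 1) (j + 1) := fun j k hkj => by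
    induction j, hkj using Nat.le_induction with
    | base => simp [pathWeight]
    | succ j hj ih =>
      rw [pathWeight_succ e (by omega)]
      calc ‖z (j + 1) - z k‖ = ‖(z j - z k) + (z (j + 1) - z j)‖ := by simp
        _ ≤ ‖z j - z k‖ + ‖z (j + 1) - z j‖ := norm_add_le _ _
        _ ≤ _ := add_le_add ih (hz j)
  have hTD : 0 < (T : ℝ) + 2 * D := by
    have : (0 : ℝ) < T := by exact_mod_cast hT1
    positivity
  set K := (T + 2 * D) * (2 * Q / a)
  have hK : 0 < K := by positivity
  have hKG : ∀ i, K * (a / (2 * Q) * G i) = (T + 2 * D) * G i := fun i => by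
    simp only [K]
    field_simp
  have hpath : IsDirectedPath (fun i => z (κ i)) (fun i => (Q * G i)⁻¹ • p (κ i))
      (fun i => a / (2 * Q) * G i) K := by
    refine ⟨hK, fun i => mul_nonneg (by positivity) (hG i), fun i => ?_, fun i => ?_,
      fun i r hir => ?_⟩
    · rw [norm_smul, norm_inv, Real.norm_of_nonneg (mul_nonneg hQ.le (hG i))]
      exact inv_mul_le_one_of_le₀ (hpQ i) (mul_nonneg hQ.le (hG i))
    · rw [hKG]
      exact (hlen _ _ (by have := hκstep i; omega)).trans (hblock i)
    · rcases (hG i).eq_or_lt with h0 | h0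
      · simp [← h0]
      have hir' := hκlt i r hir
      have h1 := hpz (κ i) (κ r) (by omega)
      have h2 : S (κ i) ≤ pathWeight (fun i => e i ^ 2) (κ i + 1) (κ r + 1) :=
        pathWeight_mono he2 le_rfl (by omega)
      have h3 := hκgood i
      rw [real_inner_smul_left, ← div_eq_inv_mul, le_div_iff₀ (by positivity),
        ← neg_sub (z (κ r)), inner_neg_right]
      have h4 : a / (2 * Q) * G i * (Q * G i) = a / 2 * S (κ i) := by
        rw [← hGsq]
        field_simp
      rw [h4]
      nlinarith [mul_le_mul_of_nonneg_left h2 ha.le, mul_le_mul_of_nonneg_left h3 ha.le]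
  obtain ⟨B, hB⟩ := hpath.exists_weight_le fun i j => hR _ _
  refine summable_of_pathWeight_le he (κ 0) (C := K * B) fun M hM => ?_
  have hN : ∀ N, pathWeight e (κ 0 + 1) (κ N + 1) ≤
      K * pathWeight (fun i => a / (2 * Q) * G i) 0 N := fun N => by
    induction N with
    | zero => simp [pathWeight]
    | succ N ih =>
      have h0 : κ 0 ≤ κ N := by
        rcases Nat.eq_zero_or_pos N with rfl | hN
        · exact le_rfl
        · have := hκlt 0 N hN
          omega
      rw [pathWeight_succ _ (Nat.zero_le N), mul_add, hKG,
        ← pathWeight_add e (show κ 0 + 1 ≤ κ N + 1 by omega)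
          (show κ N + 1 ≤ κ (N + 1) + 1 by have := hκstep N; omega)]
      exact add_le_add ih (hblock N)
  calc pathWeight e (κ 0 + 1) (M + 1) ≤ pathWeight e (κ 0 + 1) (κ M + 1) :=
        pathWeight_mono he le_rfl (Nat.succ_le_succ (hκge M))
    _ ≤ _ := hN M
    _ ≤ K * B := by
      gcongr
      exact hB M

section Linear

variable {ι κ : Type*} [Fintype ι] [Fintype κ]

theorem nrm_eq_norm (v : ι → ℝ) : nrm v = ‖WithLp.toLp 2 v‖ := by
  rw [nrm, norm_eq_sqrt_real_inner, EuclideanSpace.inner_toLp_toLp, star_trivial]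

theorem nrm_nonneg (v : ι → ℝ) : 0 ≤ nrm v := Real.sqrt_nonneg _

theorem nrm_sq (v : ι → ℝ) : nrm v ^ 2 = v ⬝ᵥ v := by
  rw [nrm_eq_norm, ← real_inner_self_eq_norm_sq, EuclideanSpace.inner_toLp_toLp, star_trivial]

theorem dotProduct_self_nonneg_real (v : ι → ℝ) : 0 ≤ v ⬝ᵥ v := nrm_sq v ▸ sq_nonneg _

theorem dotProduct_le_nrm_mul_nrm (u v : ι → ℝ) : u ⬝ᵥ v ≤ nrm u * nrm v := by
  have := real_inner_le_norm (WithLp.toLp 2 u) (WithLp.toLp 2 v)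
  rwa [EuclideanSpace.inner_toLp_toLp, star_trivial, dotProduct_comm, ← nrm_eq_norm,
    ← nrm_eq_norm] at this

theorem nrm_add_le (u v : ι → ℝ) : nrm (u + v) ≤ nrm u + nrm v := by
  simp only [nrm_eq_norm, WithLp.toLp_add]
  exact norm_add_le _ _

theorem nrm_neg (v : ι → ℝ) : nrm (-v) = nrm v := by simp [nrm]

theorem nrm_sub_le (u v : ι → ℝ) : nrm (u - v) ≤ nrm u + nrm v := by
  rw [sub_eq_add_neg, ← nrm_neg v]
  exact nrm_add_le _ _

theorem nrm_smul (s : ℝ) (v : ι → ℝ) : nrm (s • v) = |s| * nrm v := by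
  simp only [nrm_eq_norm, WithLp.toLp_smul, norm_smul, Real.norm_eq_abs]

theorem norm_le_nrm (v : ι → ℝ) : ‖v‖ ≤ nrm v := by
  rw [nrm_eq_norm]
  exact (pi_norm_le_iff_of_nonneg (norm_nonneg _)).2 fun i =>
    PiLp.norm_apply_le (WithLp.toLp 2 v) i

theorem nrm_eq_zero {v : ι → ℝ} (h : nrm v = 0) : v = 0 := by
  have := norm_le_nrm v
  rw [h] at this
  exact norm_le_zero_iff.1 this

theorem exists_eq_smul_of_ne_zero {v : ι → ℝ} (hv : v ≠ 0) :
    ∃ u : ι → ℝ, u ⬝ᵥ u = 1 ∧ v = nrm v • u := by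
  have h : nrm v ≠ 0 := fun h => hv (nrm_eq_zero h)
  refine ⟨(nrm v)⁻¹ • v, ?_, by rw [smul_inv_smul₀ h]⟩
  rw [smul_dotProduct, dotProduct_smul, ← nrm_sq, smul_eq_mul, smul_eq_mul]
  field_simp

theorem isCompact_dotProduct_self_eq_one : IsCompact {v : ι → ℝ | v ⬝ᵥ v = 1} := by
  refine Metric.isCompact_of_isClosed_isBounded (isClosed_eq (by fun_prop) (by fun_prop)) ?_
  refine (Metric.isBounded_closedBall (x := (0 : ι → ℝ)) (r := 1)).subset fun v hv => ?_
  rw [mem_closedBall_zero_iff]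
  refine (norm_le_nrm v).trans ?_
  rw [nrm, hv, Real.sqrt_one]

theorem nrm_mulVec_le (A : Matrix ι κ ℝ) (v : κ → ℝ) : nrm (A *ᵥ v) ≤ specNorm A * nrm v := by
  rcases eq_or_ne v 0 with rfl | hv
  · simp [nrm]
  obtain ⟨u, hu, huv⟩ := exists_eq_smul_of_ne_zero hv
  have hcont : Continuous fun v : κ → ℝ => nrm (A *ᵥ v) := by
    unfold nrm
    fun_prop
  have hbdd : BddAbove {r | ∃ v : κ → ℝ, v ⬝ᵥ v = 1 ∧ r = nrm (A *ᵥ v)} := by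
    obtain ⟨B, hB⟩ := isCompact_dotProduct_self_eq_one.bddAbove_image hcont.continuousOn
    refine ⟨B, ?_⟩
    rintro _ ⟨v, hv, rfl⟩
    exact hB ⟨v, hv, rfl⟩
  have h1 : nrm (A *ᵥ u) ≤ specNorm A := le_csSup hbdd ⟨u, hu, rfl⟩
  calc nrm (A *ᵥ v) = nrm v * nrm (A *ᵥ u) := by
        conv_lhs => rw [huv, mulVec_smul, nrm_smul, abs_of_nonneg (nrm_nonneg v)]
    _ ≤ nrm v * specNorm A := by
        have := nrm_nonneg v
        gcongr
    _ = _ := mul_comm _ _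

theorem specNorm_nonneg (A : Matrix ι κ ℝ) : 0 ≤ specNorm A :=
  Real.sSup_nonneg (by
    rintro _ ⟨v, -, rfl⟩
    exact nrm_nonneg _)

theorem dotProduct_mulVec_eq_transpose (A : Matrix ι κ ℝ) (u : ι → ℝ) (v : κ → ℝ) :
    u ⬝ᵥ A *ᵥ v = Aᵀ *ᵥ u ⬝ᵥ v := by
  rw [dotProduct_mulVec, mulVec_transpose]

theorem posDef_transpose {α : Type*} {M : Matrix α α ℝ} (hM : M.PosDef) : Mᵀ = M := by
  have := hM.isHermitian
  rwa [IsHermitian, conjTranspose_eq_transpose_of_trivial] at this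

theorem posDef_dotProduct_nonneg {M : Matrix ι ι ℝ} (hM : M.PosDef) (v : ι → ℝ) :
    0 ≤ v ⬝ᵥ M *ᵥ v := by
  rcases eq_or_ne v 0 with rfl | hv
  · simp
  · simpa using (hM.dotProduct_mulVec_pos hv).le

theorem exists_pos_mul_le_of_posDef {M : Matrix ι ι ℝ} (hM : M.PosDef) :
    ∃ a > 0, ∀ v : ι → ℝ, a * (v ⬝ᵥ v) ≤ v ⬝ᵥ M *ᵥ v := by
  by_cases hne : {v : ι → ℝ | v ⬝ᵥ v = 1}.Nonempty
  · obtain ⟨u, hu, hmin⟩ := isCompact_dotProduct_self_eq_one.exists_isMinOn hne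
      (f := fun v => v ⬝ᵥ M *ᵥ v) (by fun_prop)
    have hu0 : u ≠ 0 := by
      rintro rfl
      simp at hu
    refine ⟨u ⬝ᵥ M *ᵥ u, by simpa using hM.dotProduct_mulVec_pos hu0, fun v => ?_⟩
    rcases eq_or_ne v 0 with rfl | hv
    · simp
    obtain ⟨w, hw, hwv⟩ := exists_eq_smul_of_ne_zero hv
    have h1 : u ⬝ᵥ M *ᵥ u ≤ w ⬝ᵥ M *ᵥ w := hmin hw
    have h2 : v ⬝ᵥ M *ᵥ v = nrm v ^ 2 * (w ⬝ᵥ M *ᵥ w) := by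
      conv_lhs => rw [hwv, mulVec_smul, smul_dotProduct, dotProduct_smul, smul_eq_mul, smul_eq_mul]
      ring
    rw [h2, ← nrm_sq, mul_comm]
    gcongr
  · refine ⟨1, one_pos, fun v => ?_⟩
    rcases eq_or_ne v 0 with rfl | hv
    · simp
    obtain ⟨w, hw, -⟩ := exists_eq_smul_of_ne_zero hv
    exact absurd ⟨w, hw⟩ hne

theorem dotProduct_mulVec_self_le_specNorm (M : Matrix ι ι ℝ) (v : ι → ℝ) :
    v ⬝ᵥ M *ᵥ v ≤ specNorm M * (v ⬝ᵥ v) := by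
  have h1 := dotProduct_le_nrm_mul_nrm v (M *ᵥ v)
  have h2 := mul_le_mul_of_nonneg_left (nrm_mulVec_le M v) (nrm_nonneg v)
  rw [← nrm_sq]
  linarith

variable [DecidableEq ι]

theorem posDef_inv_mul {M : Matrix ι ι ℝ} (hM : M.PosDef) : M⁻¹ * M = 1 :=
  nonsing_inv_mul M ((isUnit_iff_isUnit_det M).1 hM.isUnit)

theorem posDef_mul_inv {M : Matrix ι ι ℝ} (hM : M.PosDef) : M * M⁻¹ = 1 :=
  mul_nonsing_inv M ((isUnit_iff_isUnit_det M).1 hM.isUnit)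

theorem posDef_inv_mulVec {M : Matrix ι ι ℝ} (hM : M.PosDef) (v : ι → ℝ) :
    M⁻¹ *ᵥ (M *ᵥ v) = v := by
  rw [mulVec_mulVec, posDef_inv_mul hM, one_mulVec]

theorem posDef_mulVec_inv {M : Matrix ι ι ℝ} (hM : M.PosDef) (v : ι → ℝ) :
    M *ᵥ (M⁻¹ *ᵥ v) = v := by
  rw [mulVec_mulVec, posDef_mul_inv hM, one_mulVec]

/-- Completing the square for the quadratic form of `M⁻¹`. -/
theorem inv_quadratic_sub {M : Matrix ι ι ℝ} (hM : M.PosDef) (u v : ι → ℝ) :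
    (u - M *ᵥ v) ⬝ᵥ M⁻¹ *ᵥ (u - M *ᵥ v) =
      u ⬝ᵥ M⁻¹ *ᵥ u - 2 * (u ⬝ᵥ v) + v ⬝ᵥ M *ᵥ v := by
  have h1 : M *ᵥ v ⬝ᵥ M⁻¹ *ᵥ u = v ⬝ᵥ u := by
    have := dotProduct_mulVec_eq_transpose M v (M⁻¹ *ᵥ u)
    rw [posDef_transpose hM, posDef_mulVec_inv hM] at this
    exact this.symm
  rw [mulVec_sub, posDef_inv_mulVec hM, sub_dotProduct, dotProduct_sub, dotProduct_sub, h1,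
    dotProduct_comm (M *ᵥ v) v, dotProduct_comm v u]
  ring

theorem dotProduct_self_le_specNorm_mul_inv {M : Matrix ι ι ℝ} (hM : M.PosDef) (w : ι → ℝ) :
    w ⬝ᵥ w ≤ specNorm M * (w ⬝ᵥ M⁻¹ *ᵥ w) := by
  obtain ⟨σ, hσ⟩ : ∃ σ, σ = specNorm M := ⟨_, rfl⟩
  rw [← hσ]
  rcases (hσ ▸ specNorm_nonneg M : 0 ≤ σ).eq_or_lt with h0 | h0
  · have h1 := nrm_mulVec_le M (M⁻¹ *ᵥ w)
    rw [posDef_mulVec_inv hM, ← hσ, ← h0, zero_mul] at h1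
    rw [nrm_eq_zero (le_antisymm h1 (nrm_nonneg w))]
    simp
  · have h1 := posDef_dotProduct_nonneg hM (σ • (M⁻¹ *ᵥ w) - w)
    have h2 := dotProduct_mulVec_self_le_specNorm M w
    have h3 : M⁻¹ *ᵥ w ⬝ᵥ M *ᵥ w = w ⬝ᵥ w := by
      rw [dotProduct_mulVec_eq_transpose, posDef_transpose hM, posDef_mulVec_inv hM]
    rw [mulVec_sub, mulVec_smul, posDef_mulVec_inv hM, sub_dotProduct, dotProduct_sub,
      dotProduct_sub, smul_dotProduct, smul_dotProduct, dotProduct_smul, dotProduct_smul, h3,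
      dotProduct_comm (M⁻¹ *ᵥ w)] at h1
    simp only [smul_eq_mul] at h1
    rw [← hσ] at h2
    by_contra! hcon
    nlinarith [mul_lt_mul_of_pos_left hcon h0]

/-- The step-size condition on `M` makes the quadratic form of `M⁻¹` dominate `1 / μ`. -/
theorem dotProduct_self_le_mul_inv {M : Matrix ι ι ℝ} {μ : ℝ} (hμ : 0 < μ) (hM : M.PosDef)
    (hC : ((1 / 2 : ℝ) • M⁻¹ - (specNorm M / μ ^ 2) • (1 : Matrix ι ι ℝ)).PosDef) (w : ι → ℝ) :
    w ⬝ᵥ w ≤ μ * (w ⬝ᵥ M⁻¹ *ᵥ w) := by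
  have h1 := dotProduct_self_le_specNorm_mul_inv hM w
  have h2 := posDef_dotProduct_nonneg hC w
  have hσ := specNorm_nonneg M
  rw [sub_mulVec, smul_mulVec, smul_mulVec, one_mulVec, dotProduct_sub, dotProduct_smul,
    dotProduct_smul, smul_eq_mul, smul_eq_mul] at h2
  have hW := dotProduct_self_nonneg_real w
  have hq : 0 ≤ w ⬝ᵥ M⁻¹ *ᵥ w := by
    have := mul_nonneg (div_nonneg hσ (sq_nonneg μ)) hW
    linarith
  generalize w ⬝ᵥ M⁻¹ *ᵥ w = q at *
  generalize w ⬝ᵥ w = W at *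
  generalize specNorm M = σ at *
  have h3 : 2 * σ * W ≤ μ ^ 2 * q := by
    have : σ / μ ^ 2 * W = σ * W / μ ^ 2 := by ring
    rw [this] at h2
    have h4 : σ * W / μ ^ 2 ≤ q / 2 := by linarith
    rw [div_le_iff₀ (by positivity)] at h4
    linarith
  refine abs_le_of_sq_le_sq' ?_ (by positivity) |>.2
  nlinarith [mul_le_mul_of_nonneg_right h3 hq, mul_le_mul_of_nonneg_left h1 hW, sq_nonneg W]

end Linear

section Convex

variable {ι : Type*} [Fintype ι]

theorem nonneg_of_forall_add_mul_nonneg {α β : ℝ} (h : ∀ t, 0 < t → t ≤ 1 → 0 ≤ α + t * β) :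
    0 ≤ α := by
  by_contra! hα
  have hβ : 0 < |β| + 1 := by positivity
  have h1 := h (min 1 (-α / (2 * (|β| + 1))))
    (lt_min one_pos (div_pos (by linarith) (by positivity)))
    (min_le_left _ _)
  have h2 : min 1 (-α / (2 * (|β| + 1))) * β ≤ -α / (2 * (|β| + 1)) * (|β| + 1) := by
    have h3 : 0 ≤ min 1 (-α / (2 * (|β| + 1))) :=
      le_min zero_le_one (div_nonneg (by linarith) (by positivity))
    exact mul_le_mul_of_nonneg (min_le_right _ _) (by linarith [le_abs_self β]) h3 (by positivity)
  have h3 : -α / (2 * (|β| + 1)) * (|β| + 1) = -α / 2 := by field_simp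
  linarith

theorem exists_eq_coe {a : EReal} (h : a ≠ ⊤) (h' : a ≠ ⊥) : ∃ r : ℝ, a = r :=
  ⟨a.toReal, (EReal.coe_toReal h h').symm⟩

theorem ne_top_of_add_coe_le {a b : EReal} {r : ℝ} (h : a + r ≤ b) (hb : b ≠ ⊤) : a ≠ ⊤ := by
  rintro rfl
  rw [EReal.top_add_coe] at h
  exact hb (top_le_iff.1 h)

theorem IsProxPt.ne_top {M : Matrix ι ι ℝ} {f : (ι → ℝ) → EReal} {y p : ι → ℝ}
    (hp : IsProxPt M f y p) (hf : ProperE f) : f p ≠ ⊤ := by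
  obtain ⟨w, hw⟩ := hf.1
  obtain ⟨b, hb⟩ := exists_eq_coe hw (hf.2 w)
  have h := hp w
  rw [hb, ← EReal.coe_add] at h
  exact ne_top_of_add_coe_le h (EReal.coe_ne_top _)

/-- First-order optimality of a proximal point of a strongly convex function. -/
theorem IsProxPt.add_le {M : Matrix ι ι ℝ} (hM : M.PosDef) {f : (ι → ℝ) → EReal} {μ : ℝ}
    {y p : ι → ℝ} (hp : IsProxPt M f y p) (hf : ProperE f) (hsc : StrongConvexE μ f) (w : ι → ℝ) :
    f p + (((w - p) ⬝ᵥ (-(M *ᵥ (p - y))) + μ / 2 * ((w - p) ⬝ᵥ (w - p)) : ℝ) : EReal) ≤ f w := by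
  rcases eq_or_ne (f w) ⊤ with hw | hw
  · rw [hw]
    exact le_top
  obtain ⟨b, hb⟩ := exists_eq_coe hw (hf.2 w)
  obtain ⟨a, ha⟩ := exists_eq_coe (hp.ne_top hf) (hf.2 p)
  rw [ha, hb, ← EReal.coe_add, EReal.coe_le_coe_iff]
  have key : 0 ≤ b - a - μ / 2 * ((w - p) ⬝ᵥ (w - p)) + (w - p) ⬝ᵥ M *ᵥ (p - y) := by
    refine nonneg_of_forall_add_mul_nonneg
      (β := μ / 2 * ((w - p) ⬝ᵥ (w - p)) + 1 / 2 * ((w - p) ⬝ᵥ M *ᵥ (w - p))) fun t ht ht1 => ?_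
    have h1 := hsc w p t ht.le ht1
    have h2 := hp (t • w + (1 - t) • p)
    rw [ha, hb, ← EReal.coe_mul, ← EReal.coe_mul, ← EReal.coe_add] at h1
    obtain ⟨r, hr⟩ := exists_eq_coe (ne_top_of_add_coe_le h1 (EReal.coe_ne_top _))
      (hf.2 (t • w + (1 - t) • p))
    rw [hr, ← EReal.coe_add, EReal.coe_le_coe_iff] at h1
    rw [hr, ha, ← EReal.coe_add, ← EReal.coe_add, EReal.coe_le_coe_iff] at h2
    have h3 : t • w + (1 - t) • p - y = t • (w - p) + (p - y) := by module
    have h4 : (p - y) ⬝ᵥ M *ᵥ (w - p) = (w - p) ⬝ᵥ M *ᵥ (p - y) := by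
      rw [dotProduct_mulVec_eq_transpose, posDef_transpose hM, dotProduct_comm]
    rw [h3, mulVec_add, mulVec_smul, add_dotProduct, dotProduct_add, dotProduct_add,
      smul_dotProduct, smul_dotProduct, dotProduct_smul, dotProduct_smul, h4] at h2
    simp only [smul_eq_mul] at h2
    refine nonneg_of_mul_nonneg_right (a := t) ?_ ht
    linarith
  rw [dotProduct_neg]
  linarith

theorem conjE_ne_bot {g : (ι → ℝ) → EReal} (hg : ProperE g) (y : ι → ℝ) : conjE g y ≠ ⊥ := by
  obtain ⟨w, hw⟩ := hg.1
  obtain ⟨b, hb⟩ := exists_eq_coe hw (hg.2 w)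
  have h : ((w ⬝ᵥ y : ℝ) : EReal) - g w ≤ conjE g y :=
    le_iSup (fun x : ι → ℝ => ((x ⬝ᵥ y : ℝ) : EReal) - g x) w
  rw [hb, ← EReal.coe_sub] at h
  exact ne_bot_of_le_ne_bot (EReal.coe_ne_bot _) h

theorem SubgradAt.ne_top {f : (ι → ℝ) → EReal} {x v w : ι → ℝ} (h : SubgradAt f x v)
    (hw : f w ≠ ⊤) : f x ≠ ⊤ :=
  ne_top_of_add_coe_le (h w) hw

theorem conjE_le_of_forall {f : (ι → ℝ) → EReal} {y : ι → ℝ} {r : ℝ} (hbot : ∀ x, f x ≠ ⊥)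
    (h : ∀ x, ∀ b : ℝ, f x = b → x ⬝ᵥ y - b ≤ r) : conjE f y ≤ r := by
  refine iSup_le fun x => ?_
  rcases eq_or_ne (f x) ⊤ with hx | hx
  · rw [hx, EReal.sub_top]
    exact bot_le
  obtain ⟨b, hb⟩ := exists_eq_coe hx (hbot x)
  rw [hb, ← EReal.coe_sub, EReal.coe_le_coe_iff]
  exact h x b hb

theorem conjE_ne_top_of_subgradAt {g : (ι → ℝ) → EReal} (hg : ProperE g) {x y : ι → ℝ}
    (h : SubgradAt g x y) : conjE g y ≠ ⊤ := by
  obtain ⟨w, hw⟩ := hg.1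
  obtain ⟨a, ha⟩ := exists_eq_coe (h.ne_top hw) (hg.2 x)
  refine ne_top_of_le_ne_top (EReal.coe_ne_top (x ⬝ᵥ y - a)) (conjE_le_of_forall hg.2 ?_)
  intro u b hb
  have h1 := h u
  rw [ha, hb, ← EReal.coe_add, EReal.coe_le_coe_iff, sub_dotProduct] at h1
  linarith

theorem lowerSemicontinuous_conjE {g : (ι → ℝ) → EReal} (hg : ∀ x, g x ≠ ⊥) :
    LowerSemicontinuous (conjE g) := by
  have h : ∀ x : ι → ℝ, LowerSemicontinuous fun y : ι → ℝ => ((x ⬝ᵥ y : ℝ) : EReal) - g x := by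
    intro x
    rcases eq_or_ne (g x) ⊤ with hx | hx
    · simp only [hx, EReal.sub_top]
      exact lowerSemicontinuous_const
    obtain ⟨b, hb⟩ := exists_eq_coe hx (hg x)
    have hcont : Continuous fun y : ι → ℝ => x ⬝ᵥ y - b := by fun_prop
    have hcoe : Continuous fun y : ι → ℝ => ((x ⬝ᵥ y - b : ℝ) : EReal) :=
      continuous_coe_real_ereal.comp hcont
    have heq : (fun y : ι → ℝ => ((x ⬝ᵥ y : ℝ) : EReal) - g x) =
        fun y => ((x ⬝ᵥ y - b : ℝ) : EReal) := by
      funext y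
      rw [hb, EReal.coe_sub]
    rw [heq]
    exact hcoe.lowerSemicontinuous
  intro y r hr
  obtain ⟨x, hx⟩ := lt_iSup_iff.1 hr
  filter_upwards [h x y r hx] with u hu
  exact hu.trans_le (le_iSup (fun x : ι → ℝ => ((x ⬝ᵥ u : ℝ) : EReal) - g x) x)

/-- The graph of the subdifferential of a lower semicontinuous function is closed. -/
theorem SubgradAt.of_tendsto {f : (ι → ℝ) → EReal} (hf : LowerSemicontinuous f)
    (hbot : ∀ x, f x ≠ ⊥) {x v : ℕ → ι → ℝ} {X V : ι → ℝ} (h : ∀ k, SubgradAt f (x k) (v k))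
    (hx : Tendsto x atTop (nhds X)) (hv : Tendsto v atTop (nhds V)) : SubgradAt f X V := by
  intro y
  rcases eq_or_ne (f y) ⊤ with hy | hy
  · rw [hy]
    exact le_top
  obtain ⟨b, hb⟩ := exists_eq_coe hy (hbot y)
  have hlim : Tendsto (fun k => b - (y - x k) ⬝ᵥ v k) atTop (nhds (b - (y - X) ⬝ᵥ V)) := by
    have hcont : Continuous fun q : (ι → ℝ) × (ι → ℝ) => b - (y - q.1) ⬝ᵥ q.2 := by fun_prop
    have hpair : Tendsto (fun k => (x k, v k)) atTop (nhds (X, V)) := hx.prodMk_nhds hv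
    have hcomp := (hcont.tendsto (X, V)).comp hpair
    exact hcomp
  have hle : f X ≤ ((b - (y - X) ⬝ᵥ V : ℝ) : EReal) := by
    by_contra! hlt
    obtain ⟨q, hq1, hq2⟩ := EReal.lt_iff_exists_real_btwn.1 hlt
    rw [EReal.coe_lt_coe_iff] at hq1
    obtain ⟨k, hk1, hk2⟩ := ((hx.eventually (hf X q hq2)).and
      (hlim.eventually (gt_mem_nhds hq1))).exists
    have h1 := h k y
    obtain ⟨a, ha⟩ := exists_eq_coe ((h k).ne_top hy) (hbot (x k))
    rw [ha, hb, ← EReal.coe_add, EReal.coe_le_coe_iff] at h1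
    rw [ha, gt_iff_lt, EReal.coe_lt_coe_iff] at hk1
    linarith
  obtain ⟨a, ha⟩ := exists_eq_coe (ne_top_of_le_ne_top (EReal.coe_ne_top _) hle) (hbot X)
  rw [ha, EReal.coe_le_coe_iff] at hle
  rw [ha, hb, ← EReal.coe_add, EReal.coe_le_coe_iff]
  linarith

end Convex

section Lyapunov

variable {ι κ : Type*} [Fintype ι] [Fintype κ] [DecidableEq ι]

/-- The energy `g*(z) - f(x) - ⟨x, Aᵀz⟩ + ½‖Aᵀz + s‖²` in the norm of `M⁻¹`, where `φ = f(x)` and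
`G = g*(z)`. -/
def lyapunov (A : Matrix κ ι ℝ) (M : Matrix ι ι ℝ) (φ G : ℝ) (x s : ι → ℝ) (z : κ → ℝ) : ℝ :=
  G - φ - x ⬝ᵥ Aᵀ *ᵥ z + 1 / 2 * ((Aᵀ *ᵥ z + s) ⬝ᵥ M⁻¹ *ᵥ (Aᵀ *ᵥ z + s))

theorem lyapunov_descent {A : Matrix κ ι ℝ} {M : Matrix ι ι ℝ} (hM : M.PosDef) {N : Matrix κ κ ℝ}
    {φ φ' G G' : ℝ} {x x' s s' : ι → ℝ} {z z' e : κ → ℝ}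
    (hs' : s' = -(Aᵀ *ᵥ z) - M *ᵥ (x' - x)) (hφ : φ + (x' - x) ⬝ᵥ s ≤ φ')
    (hG : G' + (z - z') ⬝ᵥ (-(N *ᵥ (z' - z)) + A *ᵥ (x' + (x' - x)) - e) ≤ G) :
    lyapunov A M φ' G' x' s' z' ≤ lyapunov A M φ G x s z -
      (z' - z) ⬝ᵥ (N - (1 / 2 : ℝ) • (A * M⁻¹ * Aᵀ)) *ᵥ (z' - z) - (z' - z) ⬝ᵥ e -
      1 / 2 * ((s' - s) ⬝ᵥ M⁻¹ *ᵥ (s' - s)) + (x' - x) ⬝ᵥ M *ᵥ (x' - x) := by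
  obtain ⟨d, hd⟩ : ∃ d, d = z' - z := ⟨_, rfl⟩
  obtain ⟨v, hv⟩ : ∃ v, v = x' - x := ⟨_, rfl⟩
  obtain ⟨w, hw⟩ : ∃ w, w = Aᵀ *ᵥ z + s := ⟨_, rfl⟩
  have hz' : z' = z + d := by rw [hd]; abel
  have hx' : x' = x + v := by rw [hv]; abel
  have hw' : Aᵀ *ᵥ z' + s' = Aᵀ *ᵥ d - M *ᵥ v := by
    rw [hs', hz', ← hv, mulVec_add]
    abel
  have hΔ : s' - s = -(w - M *ᵥ (-v)) := by
    rw [hs', ← hv, hw, mulVec_neg]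
    abel
  have hzd : z - z' = -d := by rw [hd]; abel
  have hsw : s = w - Aᵀ *ᵥ z := by rw [hw]; abel
  have e1 := inv_quadratic_sub hM (Aᵀ *ᵥ d) v
  have e2 := inv_quadratic_sub hM w (-v)
  have e3 : d ⬝ᵥ (A * M⁻¹ * Aᵀ) *ᵥ d = Aᵀ *ᵥ d ⬝ᵥ M⁻¹ *ᵥ Aᵀ *ᵥ d := by
    rw [← mulVec_mulVec, ← mulVec_mulVec, dotProduct_mulVec_eq_transpose A]
  have e5 : ∀ u : ι → ℝ, (-u) ⬝ᵥ M⁻¹ *ᵥ (-u) = u ⬝ᵥ M⁻¹ *ᵥ u := fun u => by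
    rw [mulVec_neg, neg_dotProduct, dotProduct_neg, neg_neg]
  have e4 : ∀ u : ι → ℝ, d ⬝ᵥ A *ᵥ u = u ⬝ᵥ Aᵀ *ᵥ d := fun u => by
    rw [dotProduct_mulVec_eq_transpose A, dotProduct_comm]
  unfold lyapunov
  rw [hw', ← hw, e1, hΔ, e5, e2, ← hd, ← hv,
    sub_mulVec, smul_mulVec, dotProduct_sub, dotProduct_smul, smul_eq_mul, e3]
  rw [hzd, ← hd, ← hv] at hG
  rw [← hv, hsw, dotProduct_sub] at hφ
  simp only [neg_dotProduct, dotProduct_neg, dotProduct_sub, dotProduct_add, mulVec_add, mulVec_neg,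
    e4, neg_neg, hx', add_dotProduct, hz', dotProduct_comm w v, dotProduct_comm (Aᵀ *ᵥ d) v]
    at hG hφ ⊢
  linarith

theorem lyapunov_lower_bound {A : Matrix κ ι ℝ} {M : Matrix ι ι ℝ} {μ : ℝ} (hμ : 0 < μ)
    (hM : ∀ w : ι → ℝ, w ⬝ᵥ w ≤ μ * (w ⬝ᵥ M⁻¹ *ᵥ w)) {φ b G : ℝ} {x s y : ι → ℝ} {z : κ → ℝ}
    (hφ : φ + ((y - x) ⬝ᵥ s + μ / 2 * ((y - x) ⬝ᵥ (y - x))) ≤ b) :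
    G - b - y ⬝ᵥ Aᵀ *ᵥ z ≤ lyapunov A M φ G x s z := by
  obtain ⟨u, hu⟩ : ∃ u, u = y - x := ⟨_, rfl⟩
  obtain ⟨w, hw⟩ : ∃ w, w = Aᵀ *ᵥ z + s := ⟨_, rfl⟩
  have hy : y = x + u := by rw [hu]; abel
  have hs : s = w - Aᵀ *ᵥ z := by rw [hw]; abel
  unfold lyapunov
  rw [← hw]
  rw [← hu, hs, dotProduct_sub] at hφ
  rw [hy, add_dotProduct]
  have h1 := hM w
  have h2 := dotProduct_self_nonneg_real (μ • u + w)
  simp only [add_dotProduct, dotProduct_add, smul_dotProduct, dotProduct_smul, smul_eq_mul,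
    dotProduct_comm w u] at h2
  refine le_of_mul_le_mul_left ?_ hμ
  nlinarith

theorem lyapunov_ge {A : Matrix κ ι ℝ} {M : Matrix ι ι ℝ} {μ : ℝ} (hμ : 0 < μ)
    (hM : ∀ w : ι → ℝ, w ⬝ᵥ w ≤ μ * (w ⬝ᵥ M⁻¹ *ᵥ w)) {φ φ' G G' : ℝ} {x x' s s' : ι → ℝ}
    {z z' ζ : κ → ℝ} (hφ : φ' + ((x - x') ⬝ᵥ s' + μ / 2 * ((x - x') ⬝ᵥ (x - x'))) ≤ φ)
    (hG : G + (z' - z) ⬝ᵥ ζ ≤ G') :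
    lyapunov A M φ G x s z - 1 / 2 * ((Aᵀ *ᵥ z + s) ⬝ᵥ M⁻¹ *ᵥ (Aᵀ *ᵥ z + s)) +
      (z' - z) ⬝ᵥ (ζ - A *ᵥ x) ≤ lyapunov A M φ' G' x' s' z' := by
  refine le_trans ?_ (lyapunov_lower_bound hμ hM hφ)
  obtain ⟨d, hd⟩ : ∃ d, d = z' - z := ⟨_, rfl⟩
  have hz' : z' = z + d := by rw [hd]; abel
  have e : d ⬝ᵥ A *ᵥ x = x ⬝ᵥ Aᵀ *ᵥ d := by
    rw [dotProduct_mulVec_eq_transpose A, dotProduct_comm]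
  have e' : x ⬝ᵥ Aᵀ *ᵥ z' = x ⬝ᵥ Aᵀ *ᵥ z + x ⬝ᵥ Aᵀ *ᵥ d := by
    rw [hz', mulVec_add, dotProduct_add]
  rw [← hd] at hG ⊢
  unfold lyapunov
  rw [dotProduct_sub, e, e']
  linarith

end Lyapunov

section Run

variable {ι κ : Type*} [Fintype ι] [Fintype κ]

/-- The first-order relations satisfied by an inexact primal-dual run: `s k` is a subgradient of `f`
at `x k` where `φ k = f (x k)`, and `ζ k` is a subgradient of `g*` at `z k` where
`G k = g* (z k)`. -/
structure IsPrimalDualRun (A : Matrix κ ι ℝ) (M₁ : Matrix ι ι ℝ) (M₂ : Matrix κ κ ℝ) (μ c : ℝ)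
    (φ G : ℕ → ℝ) (x s : ℕ → ι → ℝ) (z ζ ε : ℕ → κ → ℝ) : Prop where
  s_succ : ∀ k, s (k + 1) = -(Aᵀ *ᵥ z k) - M₁ *ᵥ (x (k + 1) - x k)
  ζ_succ : ∀ k, ζ (k + 1) = -(M₂ *ᵥ (z (k + 1) - z k)) +
    A *ᵥ (x (k + 1) + (x (k + 1) - x k)) - ε (k + 1)
  φ_le : ∀ j k, φ (j + 1) + ((x (k + 1) - x (j + 1)) ⬝ᵥ s (j + 1) +
    μ / 2 * ((x (k + 1) - x (j + 1)) ⬝ᵥ (x (k + 1) - x (j + 1)))) ≤ φ (k + 1)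
  G_le : ∀ j k, G (j + 1) + (z (k + 1) - z (j + 1)) ⬝ᵥ ζ (j + 1) ≤ G (k + 1)
  ε_le : ∀ k, nrm (ε (k + 1)) ≤ c * nrm (z (k + 1) - z k)

/-- The joint length of the `k`-th step of the dual iterates and of the primal subgradients. -/
def stepLength (s : ℕ → ι → ℝ) (z : ℕ → κ → ℝ) (k : ℕ) : ℝ :=
  √(nrm (z (k + 1) - z k) ^ 2 + nrm (s (k + 1) - s k) ^ 2)

theorem stepLength_nonneg (s : ℕ → ι → ℝ) (z : ℕ → κ → ℝ) (k : ℕ) : 0 ≤ stepLength s z k :=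
  Real.sqrt_nonneg _

theorem stepLength_sq (s : ℕ → ι → ℝ) (z : ℕ → κ → ℝ) (k : ℕ) :
    stepLength s z k ^ 2 = nrm (z (k + 1) - z k) ^ 2 + nrm (s (k + 1) - s k) ^ 2 :=
  Real.sq_sqrt (by positivity)

theorem nrm_sub_le_stepLength_left (s : ℕ → ι → ℝ) (z : ℕ → κ → ℝ) (k : ℕ) :
    nrm (z (k + 1) - z k) ≤ stepLength s z k :=
  Real.le_sqrt_of_sq_le (by nlinarith [sq_nonneg (nrm (s (k + 1) - s k))])

theorem nrm_sub_le_stepLength_right (s : ℕ → ι → ℝ) (z : ℕ → κ → ℝ) (k : ℕ) :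
    nrm (s (k + 1) - s k) ≤ stepLength s z k :=
  Real.le_sqrt_of_sq_le (by nlinarith [sq_nonneg (nrm (z (k + 1) - z k))])

theorem exists_tendsto_of_summable {e : ℕ → ℝ} (he : Summable e) {u : ℕ → ι → ℝ} {K : ℝ}
    (hu : ∀ k, nrm (u (k + 2) - u (k + 1)) ≤ K * e k) : ∃ U, Tendsto u atTop (nhds U) := by
  have hcs : CauchySeq fun k => u (k + 1) := by
    refine cauchySeq_of_dist_le_of_summable _ (fun k => ?_) (he.mul_left K)
    rw [dist_comm, dist_eq_norm]
    exact (norm_le_nrm _).trans (hu k)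
  obtain ⟨U, hU⟩ := cauchySeq_tendsto_of_complete hcs
  exact ⟨U, (tendsto_add_atTop_iff_nat 1).1 hU⟩

theorem tendsto_zero_of_summable {e : ℕ → ℝ} (he : Summable e) {u : ℕ → ι → ℝ} {K : ℝ}
    (hu : ∀ k, nrm (u (k + 2)) ≤ K * e k) : Tendsto u atTop (nhds 0) := by
  rw [← tendsto_add_atTop_iff_nat 2]
  refine squeeze_zero_norm (fun k => (norm_le_nrm _).trans (hu k)) ?_
  simpa using he.tendsto_atTop_zero.const_mul K

namespace IsPrimalDualRun

variable {A : Matrix κ ι ℝ} {M₁ : Matrix ι ι ℝ} {M₂ : Matrix κ κ ℝ} {μ c : ℝ} {φ G : ℕ → ℝ}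
  {x s : ℕ → ι → ℝ} {z ζ ε : ℕ → κ → ℝ}

theorem mul_nrm_sub_le (h : IsPrimalDualRun A M₁ M₂ μ c φ G x s z ζ ε) (k : ℕ) :
    μ * nrm (x (k + 2) - x (k + 1)) ≤ nrm (s (k + 2) - s (k + 1)) := by
  have h1 := h.φ_le k (k + 1)
  have h2 := h.φ_le (k + 1) k
  have h3 := dotProduct_le_nrm_mul_nrm (x (k + 2) - x (k + 1)) (s (k + 2) - s (k + 1))
  rw [show x (k + 1) - x (k + 1 + 1) = -(x (k + 2) - x (k + 1)) by abel] at h2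
  simp only [neg_dotProduct, dotProduct_neg, neg_neg, ← nrm_sq] at h1 h2
  rw [dotProduct_sub] at h3
  rcases (nrm_nonneg (x (k + 2) - x (k + 1))).eq_or_lt with h0 | h0
  · rw [← h0, mul_zero]
    exact nrm_nonneg _
  · refine le_of_mul_le_mul_left ?_ h0
    linarith

theorem nrm_ζ_sub_le (h : IsPrimalDualRun A M₁ M₂ μ c φ G x s z ζ ε) (hμ : 0 < μ) (hc : 0 ≤ c)
    (k : ℕ) : nrm (ζ (k + 2) - A *ᵥ x (k + 2)) ≤
      (specNorm M₂ + specNorm A / μ + c) * stepLength s z (k + 1) := by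
  have e : ζ (k + 2) - A *ᵥ x (k + 2) = A *ᵥ (x (k + 2) - x (k + 1)) -
      M₂ *ᵥ (z (k + 2) - z (k + 1)) - ε (k + 2) := by
    rw [h.ζ_succ (k + 1), mulVec_add]
    abel
  have hs := nrm_sub_le_stepLength_right s z (k + 1)
  have hz := nrm_sub_le_stepLength_left s z (k + 1)
  have hx : nrm (x (k + 2) - x (k + 1)) ≤ stepLength s z (k + 1) / μ := by
    rw [le_div_iff₀' hμ]
    exact (h.mul_nrm_sub_le k).trans hs
  have h1 := (nrm_mulVec_le A _).trans (mul_le_mul_of_nonneg_left hx (specNorm_nonneg A))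
  have h2 := (nrm_mulVec_le M₂ _).trans (mul_le_mul_of_nonneg_left hz (specNorm_nonneg M₂))
  have h3 := (h.ε_le (k + 1)).trans (mul_le_mul_of_nonneg_left hz hc)
  have h4 := nrm_sub_le (A *ᵥ (x (k + 2) - x (k + 1)) - M₂ *ᵥ (z (k + 2) - z (k + 1))) (ε (k + 2))
  have h5 := nrm_sub_le (A *ᵥ (x (k + 2) - x (k + 1))) (M₂ *ᵥ (z (k + 2) - z (k + 1)))
  rw [e]
  calc _ ≤ specNorm A * (stepLength s z (k + 1) / μ) + specNorm M₂ * stepLength s z (k + 1) +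
        c * stepLength s z (k + 1) := by linarith
    _ = _ := by ring

theorem nrm_add_s_le (h : IsPrimalDualRun A M₁ M₂ μ c φ G x s z ζ ε) (hμ : 0 < μ) (k : ℕ) :
    nrm (Aᵀ *ᵥ z (k + 2) + s (k + 2)) ≤
      (specNorm Aᵀ + specNorm M₁ / μ) * stepLength s z (k + 1) := by
  have e : Aᵀ *ᵥ z (k + 2) + s (k + 2) = Aᵀ *ᵥ (z (k + 2) - z (k + 1)) -
      M₁ *ᵥ (x (k + 2) - x (k + 1)) := by
    rw [h.s_succ (k + 1), mulVec_sub Aᵀ]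
    abel
  have hs := nrm_sub_le_stepLength_right s z (k + 1)
  have hz := nrm_sub_le_stepLength_left s z (k + 1)
  have hx : nrm (x (k + 2) - x (k + 1)) ≤ stepLength s z (k + 1) / μ := by
    rw [le_div_iff₀' hμ]
    exact (h.mul_nrm_sub_le k).trans hs
  have h1 := (nrm_mulVec_le M₁ _).trans (mul_le_mul_of_nonneg_left hx (specNorm_nonneg M₁))
  have h2 := (nrm_mulVec_le Aᵀ _).trans (mul_le_mul_of_nonneg_left hz (specNorm_nonneg Aᵀ))
  have h5 := nrm_sub_le (Aᵀ *ᵥ (z (k + 2) - z (k + 1))) (M₁ *ᵥ (x (k + 2) - x (k + 1)))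
  rw [e]
  calc _ ≤ specNorm Aᵀ * stepLength s z (k + 1) + specNorm M₁ * (stepLength s z (k + 1) / μ) := by
        linarith
    _ = _ := by ring

/-- A run whose steps have finite total length converges, together with its subgradients. -/
theorem exists_tendsto (h : IsPrimalDualRun A M₁ M₂ μ c φ G x s z ζ ε) (hμ : 0 < μ)
    (hc : 0 ≤ c) (hsum : Summable fun k => stepLength s z (k + 1)) :
    ∃ X Z, Tendsto x atTop (nhds X) ∧ Tendsto z atTop (nhds Z) ∧
      Tendsto s atTop (nhds (-(Aᵀ *ᵥ Z))) ∧ Tendsto ζ atTop (nhds (A *ᵥ X)) := by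
  obtain ⟨X, hX⟩ := exists_tendsto_of_summable hsum (u := x) (K := μ⁻¹) fun k => by
    rw [← div_eq_inv_mul, le_div_iff₀' hμ]
    exact (h.mul_nrm_sub_le k).trans (nrm_sub_le_stepLength_right s z _)
  obtain ⟨Z, hZ⟩ := exists_tendsto_of_summable hsum (u := z) (K := 1) fun k => by
    rw [one_mul]
    exact nrm_sub_le_stepLength_left s z _
  have hs := tendsto_zero_of_summable hsum (u := fun k => Aᵀ *ᵥ z k + s k) (h.nrm_add_s_le hμ)
  have hζ := tendsto_zero_of_summable hsum (u := fun k => ζ k - A *ᵥ x k) (h.nrm_ζ_sub_le hμ hc)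
  have hA : Continuous fun v : ι → ℝ => A *ᵥ v := by fun_prop
  have hAt : Continuous fun v : κ → ℝ => Aᵀ *ᵥ v := by fun_prop
  have hAX : Tendsto (fun k => A *ᵥ x k) atTop (nhds (A *ᵥ X)) := (hA.tendsto X).comp hX
  have hAZ : Tendsto (fun k => Aᵀ *ᵥ z k) atTop (nhds (Aᵀ *ᵥ Z)) := (hAt.tendsto Z).comp hZ
  refine ⟨X, Z, hX, hZ, ?_, ?_⟩
  · simpa using hs.sub hAZ
  · simpa using hζ.add hAX

variable [DecidableEq ι]

theorem exists_lyapunov_descent [DecidableEq κ]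
    (h : IsPrimalDualRun A M₁ M₂ μ c φ G x s z ζ ε) (hμ : 0 < μ)
    (hM₁ : M₁.PosDef)
    (hC₁ : ((1 / 2 : ℝ) • M₁⁻¹ - (specNorm M₁ / μ ^ 2) • (1 : Matrix ι ι ℝ)).PosDef)
    (hC₂ : (M₂ - (1 / 2 : ℝ) • (A * M₁⁻¹ * Aᵀ) - c • (1 : Matrix κ κ ℝ)).PosDef) :
    ∃ a > 0, ∀ k, lyapunov A M₁ (φ (k + 2)) (G (k + 2)) (x (k + 2)) (s (k + 2)) (z (k + 2)) ≤
      lyapunov A M₁ (φ (k + 1)) (G (k + 1)) (x (k + 1)) (s (k + 1)) (z (k + 1)) -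
        a * stepLength s z (k + 1) ^ 2 := by
  obtain ⟨a₁, ha₁, h₁⟩ := exists_pos_mul_le_of_posDef hC₁
  obtain ⟨a₂, ha₂, h₂⟩ := exists_pos_mul_le_of_posDef hC₂
  refine ⟨min a₁ a₂, lt_min ha₁ ha₂, fun k => ?_⟩
  have hφ : φ (k + 1) + (x (k + 2) - x (k + 1)) ⬝ᵥ s (k + 1) ≤ φ (k + 2) := by
    have h1 := h.φ_le k (k + 1)
    have h2 := mul_nonneg (half_pos hμ).le (dotProduct_self_nonneg_real (x (k + 2) - x (k + 1)))
    linarith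
  have hG := h.G_le (k + 1) k
  rw [h.ζ_succ (k + 1)] at hG
  have hL := lyapunov_descent hM₁ (h.s_succ (k + 1)) hφ hG
  have hd := h₂ (z (k + 2) - z (k + 1))
  have hs := h₁ (s (k + 2) - s (k + 1))
  have hx := dotProduct_mulVec_self_le_specNorm M₁ (x (k + 2) - x (k + 1))
  have hx' : (x (k + 2) - x (k + 1)) ⬝ᵥ (x (k + 2) - x (k + 1)) ≤
      nrm (s (k + 2) - s (k + 1)) ^ 2 / μ ^ 2 := by
    rw [← nrm_sq, le_div_iff₀' (by positivity), ← mul_pow]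
    exact pow_le_pow_left₀ (mul_nonneg hμ.le (nrm_nonneg _)) (h.mul_nrm_sub_le k) 2
  have hx'' := mul_le_mul_of_nonneg_left hx' (specNorm_nonneg M₁)
  have hε : -((z (k + 2) - z (k + 1)) ⬝ᵥ ε (k + 2)) ≤ c * nrm (z (k + 2) - z (k + 1)) ^ 2 := by
    have h1 := dotProduct_le_nrm_mul_nrm (z (k + 2) - z (k + 1)) (-ε (k + 2))
    have h2 := mul_le_mul_of_nonneg_left (h.ε_le (k + 1)) (nrm_nonneg (z (k + 2) - z (k + 1)))
    rw [dotProduct_neg, nrm_neg] at h1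
    linarith
  rw [stepLength_sq]
  rw [sub_mulVec _ (c • (1 : Matrix κ κ ℝ)), smul_mulVec c, one_mulVec,
    dotProduct_sub _ (_ *ᵥ _), dotProduct_smul, smul_eq_mul, ← nrm_sq] at hd
  rw [sub_mulVec, smul_mulVec, smul_mulVec, one_mulVec, dotProduct_sub _ (_ • _), dotProduct_smul,
    dotProduct_smul, smul_eq_mul, smul_eq_mul, ← nrm_sq] at hs
  have e : specNorm M₁ * (nrm (s (k + 2) - s (k + 1)) ^ 2 / μ ^ 2) =
      specNorm M₁ / μ ^ 2 * nrm (s (k + 2) - s (k + 1)) ^ 2 := by ring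
  have hm₁ := mul_le_mul_of_nonneg_right (min_le_left a₁ a₂)
    (sq_nonneg (nrm (s (k + 2) - s (k + 1))))
  have hm₂ := mul_le_mul_of_nonneg_right (min_le_right a₁ a₂)
    (sq_nonneg (nrm (z (k + 2) - z (k + 1))))
  linarith

theorem summable_stepLength (h : IsPrimalDualRun A M₁ M₂ μ c φ G x s z ζ ε) (hμ : 0 < μ)
    (hc : 0 ≤ c) (hM₁ : M₁.PosDef)
    (hC₁ : ((1 / 2 : ℝ) • M₁⁻¹ - (specNorm M₁ / μ ^ 2) • (1 : Matrix ι ι ℝ)).PosDef) {a : ℝ}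
    (ha : 0 < a)
    (hL : ∀ k, lyapunov A M₁ (φ (k + 2)) (G (k + 2)) (x (k + 2)) (s (k + 2)) (z (k + 2)) ≤
      lyapunov A M₁ (φ (k + 1)) (G (k + 1)) (x (k + 1)) (s (k + 1)) (z (k + 1)) -
        a * stepLength s z (k + 1) ^ 2)
    {R : ℝ} (hR : ∀ k, nrm (z (k + 1)) ≤ R) : Summable fun k => stepLength s z (k + 1) := by
  set B := specNorm M₂ + specNorm A / μ + c with hB
  set D := specNorm M₁⁻¹ * (specNorm Aᵀ + specNorm M₁ / μ) ^ 2 with hD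
  have hB0 : 0 ≤ B := by
    have := specNorm_nonneg M₂
    have := specNorm_nonneg A
    positivity
  have hD0 : 0 ≤ D := by
    have := specNorm_nonneg M₁⁻¹
    positivity
  have htel : ∀ k j, k ≤ j →
      lyapunov A M₁ (φ (j + 2)) (G (j + 2)) (x (j + 2)) (s (j + 2)) (z (j + 2)) ≤
      lyapunov A M₁ (φ (k + 2)) (G (k + 2)) (x (k + 2)) (s (k + 2)) (z (k + 2)) -
        a * pathWeight (fun i => stepLength s z (i + 1) ^ 2) (k + 1) (j + 1) := by
    intro k j hkj
    induction j, hkj using Nat.le_induction with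
    | base => simp [pathWeight]
    | succ j hkj ih =>
      rw [pathWeight_succ _ (by omega : k + 1 ≤ j + 1)]
      have := hL (j + 1)
      linarith
  refine summable_of_inner_le (F := EuclideanSpace ℝ κ)
    (z := fun k => WithLp.toLp 2 (z (k + 2)))
    (p := fun k => WithLp.toLp 2 (ζ (k + 2) - A *ᵥ x (k + 2))) (a := a) (C := B + D + 1)
    (R := R + R) ha (by linarith) (fun k => stepLength_nonneg s z _) ?_ ?_ ?_ ?_
  · intro k
    rw [← WithLp.toLp_sub, ← nrm_eq_norm]
    exact nrm_sub_le_stepLength_left s z (k + 2)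
  · intro k
    rw [← nrm_eq_norm]
    refine (h.nrm_ζ_sub_le hμ hc k).trans ?_
    exact mul_le_mul_of_nonneg_right (by linarith) (stepLength_nonneg s z _)
  · intro k j hkj
    rw [← WithLp.toLp_sub, EuclideanSpace.inner_toLp_toLp, star_trivial]
    have h1 := lyapunov_ge (A := A) (s := s (k + 2)) hμ
      (dotProduct_self_le_mul_inv hμ hM₁ hC₁) (h.φ_le (j + 1) (k + 1))
      (h.G_le (k + 1) (j + 1))
    have h2 := htel k j hkj.le
    have h3 := dotProduct_mulVec_self_le_specNorm M₁⁻¹ (Aᵀ *ᵥ z (k + 2) + s (k + 2))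
    have h4 := mul_le_mul_of_nonneg_left
      (pow_le_pow_left₀ (nrm_nonneg _) (h.nrm_add_s_le hμ k) 2) (specNorm_nonneg M₁⁻¹)
    rw [nrm_sq, mul_pow, ← mul_assoc, ← hD] at h4
    have h5 := mul_nonneg hD0 (sq_nonneg (stepLength s z (k + 1)))
    have h6 := mul_nonneg hB0 (sq_nonneg (stepLength s z (k + 1)))
    have h7 := sq_nonneg (stepLength s z (k + 1))
    linarith
  · intro i j
    rw [← WithLp.toLp_sub, ← nrm_eq_norm]
    exact (nrm_sub_le _ _).trans (add_le_add (hR (i + 1)) (hR (j + 1)))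

end IsPrimalDualRun

end Run

/-- global (whole-sequence) convergence of inexact PrePDHG.  Under the
assumptions of the subsequential convergence result, if in addition `g*` is a KŁ
function, then the whole sequence `(x^k, z^k)` converges to a single primal-dual
solution pair. -/
theorem inexact_prePDHG_global_convergence {n m : ℕ}
    (f : (Fin n → ℝ) → EReal) (g : (Fin m → ℝ) → EReal)
    (μ : ℝ) (hμ : 0 < μ)
    (hfp : ProperE f) (hfc : LowerSemicontinuous f) (hfsc : StrongConvexE μ f)
    (hgp : ProperE g) (hgc : LowerSemicontinuous g) (hgv : ConvexE g)
    (A : Matrix (Fin m) (Fin n) ℝ)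
    (hsol : ∃ (xs : Fin n → ℝ) (zs : Fin m → ℝ),
      SubgradAt f xs (-(Aᵀ.mulVec zs)) ∧ SubgradAt g (A.mulVec xs) zs)
    (hcoercive : ∀ C : ℝ, ∃ R : ℝ, ∀ v : Fin m → ℝ, R < nrm v →
      (C : EReal) < conjE g v + conjE f (-(Aᵀ.mulVec v)))
    (hKL : KLFunction (conjE g))
    (M1 : Matrix (Fin n) (Fin n) ℝ) (M2 : Matrix (Fin m) (Fin m) ℝ)
    (hM1 : M1.PosDef) (hM2 : M2.PosDef)
    (c : ℝ) (hc : 0 < c)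
    (hC1 : ((1 / 2 : ℝ) • M1⁻¹ -
      (specNorm M1 / μ ^ 2) • (1 : Matrix (Fin n) (Fin n) ℝ)).PosDef)
    (hC2 : (M2 - (1 / 2 : ℝ) • (A * M1⁻¹ * Aᵀ) -
      c • (1 : Matrix (Fin m) (Fin m) ℝ)).PosDef)
    (x : ℕ → Fin n → ℝ) (z : ℕ → Fin m → ℝ) (ε : ℕ → Fin m → ℝ)
    (hx : ∀ k, IsProxPt M1 f (x k - M1⁻¹.mulVec (Aᵀ.mulVec (z k))) (x (k + 1)))
    (hz : ∀ k, SubgradAt (conjE g) (z (k + 1))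
      (-(M2.mulVec (z (k + 1) - z k -
        M2⁻¹.mulVec (A.mulVec ((2 : ℝ) • x (k + 1) - x k)))) - ε (k + 1)))
    (hε : ∀ k, nrm (ε (k + 1)) ≤ c * nrm (z (k + 1) - z k)) :
    ∃ (X : Fin n → ℝ) (Z : Fin m → ℝ),
      (SubgradAt f X (-(Aᵀ.mulVec Z)) ∧ SubgradAt (conjE g) Z (A.mulVec X)) ∧
      Tendsto x atTop (nhds X) ∧ Tendsto z atTop (nhds Z) := by
  obtain ⟨φ, hφ⟩ : ∃ φ : ℕ → ℝ, ∀ k, f (x (k + 1)) = φ (k + 1) :=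
    ⟨fun k => (f (x k)).toReal, fun k =>
      (EReal.coe_toReal ((hx k).ne_top hfp) (hfp.2 _)).symm⟩
  obtain ⟨G, hG⟩ : ∃ G : ℕ → ℝ, ∀ k, conjE g (z (k + 1)) = G (k + 1) := by
    obtain ⟨xs, zs, -, hzs⟩ := hsol
    exact ⟨fun k => (conjE g (z k)).toReal, fun k => (EReal.coe_toReal
      ((hz k).ne_top (conjE_ne_top_of_subgradAt hgp hzs)) (conjE_ne_bot hgp _)).symm⟩
  obtain ⟨s, hs⟩ : ∃ s : ℕ → Fin n → ℝ, ∀ k,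
      s (k + 1) = -(Aᵀ *ᵥ z k) - M1 *ᵥ (x (k + 1) - x k) :=
    ⟨fun k => -(Aᵀ *ᵥ z (k - 1)) - M1 *ᵥ (x k - x (k - 1)), fun k => rfl⟩
  obtain ⟨ζ, hζ⟩ : ∃ ζ : ℕ → Fin m → ℝ, ∀ k, ζ (k + 1) = -(M2 *ᵥ (z (k + 1) - z k)) +
      A *ᵥ (x (k + 1) + (x (k + 1) - x k)) - ε (k + 1) :=
    ⟨fun k => -(M2 *ᵥ (z k - z (k - 1))) + A *ᵥ (x k + (x k - x (k - 1))) - ε k, fun k => rfl⟩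
  have hfs : ∀ k w, f (x (k + 1)) + (((w - x (k + 1)) ⬝ᵥ s (k + 1) +
      μ / 2 * ((w - x (k + 1)) ⬝ᵥ (w - x (k + 1))) : ℝ) : EReal) ≤ f w := by
    intro k w
    have h := (hx k).add_le hM1 hfp hfsc w
    rwa [show x (k + 1) - (x k - M1⁻¹ *ᵥ (Aᵀ *ᵥ z k)) =
      (x (k + 1) - x k) + M1⁻¹ *ᵥ (Aᵀ *ᵥ z k) by abel, mulVec_add, posDef_mulVec_inv hM1,
      neg_add_rev, ← sub_eq_add_neg, ← hs] at h
  have hfsub : ∀ k, SubgradAt f (x (k + 1)) (s (k + 1)) := by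
    intro k w
    refine le_trans (add_le_add le_rfl (EReal.coe_le_coe_iff.2 ?_)) (hfs k w)
    have := mul_nonneg (half_pos hμ).le (dotProduct_self_nonneg_real (w - x (k + 1)))
    linarith
  have hgsub : ∀ k, SubgradAt (conjE g) (z (k + 1)) (ζ (k + 1)) := by
    intro k
    have h := hz k
    rwa [mulVec_sub, posDef_mulVec_inv hM2, neg_sub, sub_eq_neg_add (A *ᵥ _),
      show (2 : ℝ) • x (k + 1) - x k = x (k + 1) + (x (k + 1) - x k) by module, ← hζ] at h
  have hrun : IsPrimalDualRun A M1 M2 μ c φ G x s z ζ ε :=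
    { s_succ := hs
      ζ_succ := hζ
      φ_le := fun j k => by
        have h := hfs j (x (k + 1))
        rwa [hφ, hφ, ← EReal.coe_add, EReal.coe_le_coe_iff] at h
      G_le := fun j k => by
        have h := hgsub j (z (k + 1))
        rwa [hG, hG, ← EReal.coe_add, EReal.coe_le_coe_iff] at h
      ε_le := hε }
  obtain ⟨a, ha, hL⟩ := hrun.exists_lyapunov_descent hμ hM1 hC1 hC2
  obtain ⟨L, hLdef⟩ : ∃ L : ℕ → ℝ, ∀ k,
      L k = lyapunov A M1 (φ (k + 1)) (G (k + 1)) (x (k + 1)) (s (k + 1)) (z (k + 1)) :=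
    ⟨_, fun _ => rfl⟩
  have hLanti : Antitone L := antitone_nat_of_succ_le fun k => by
    rw [hLdef, hLdef]
    have := mul_nonneg ha.le (sq_nonneg (stepLength s z (k + 1)))
    linarith [hL k]
  obtain ⟨R, hR⟩ := hcoercive (L 0)
  have hzR : ∀ k, nrm (z (k + 1)) ≤ R := by
    intro k
    by_contra! hk
    refine (hR _ hk).not_ge ?_
    have hconj : conjE f (-(Aᵀ *ᵥ z (k + 1))) ≤ ((L 0 - G (k + 1) : ℝ) : EReal) := by
      refine conjE_le_of_forall hfp.2 fun y b hb => ?_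
      have h := hfs k y
      rw [hφ, hb, ← EReal.coe_add, EReal.coe_le_coe_iff] at h
      have h1 := lyapunov_lower_bound (A := A) (G := G (k + 1)) (z := z (k + 1)) hμ
        (dotProduct_self_le_mul_inv hμ hM1 hC1) h
      have h2 := hLanti (Nat.zero_le k)
      rw [hLdef k] at h2
      rw [dotProduct_neg]
      linarith
    rw [hG]
    refine (add_le_add le_rfl hconj).trans ?_
    rw [← EReal.coe_add, add_sub_cancel]
  have hsum := hrun.summable_stepLength hμ hc.le hM1 hC1 ha hL hzR
  obtain ⟨X, Z, hX, hZ, hsX, hζZ⟩ := hrun.exists_tendsto hμ hc.le hsum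
  refine ⟨X, Z, ⟨?_, ?_⟩, hX, hZ⟩
  · exact SubgradAt.of_tendsto hfc hfp.2 hfsub ((tendsto_add_atTop_iff_nat 1).2 hX)
      ((tendsto_add_atTop_iff_nat 1).2 hsX)
  · exact SubgradAt.of_tendsto (lowerSemicontinuous_conjE hgp.2) (conjE_ne_bot hgp) hgsub
      ((tendsto_add_atTop_iff_nat 1).2 hZ) ((tendsto_add_atTop_iff_nat 1).2 hζZ)
end
end

section
/- Let g* : ℝ^m → ℝ ∪ {+∞} be proper closed convex, A ∈ ℝ^{m×n} with A A^T invertible, τ > 0, M1 = τ^{-1} I_n, M2 = τ A A^T. Then for any z^k, y^k ∈ appropriate spaces and u^k ∈ ℝ^n, the preconditioned update prox^{M2}_{g*}( z^k + M2^{-1} A M1^{-1}( −A^T z^k − y^k + u^k ) ) = argmin_z { g*(z) + τ⟨ −A^T z − y^k, u^k ⟩ + (τ/2)‖A^T z + y^k‖² }, and prox^{M1^{-1}}_{f*}( u^k − A^T z^{k+1} ) = argmin_y { f*(y) + τ⟨ −A^T z^{k+1} − y, u^k ⟩ + (τ/2)‖A^T z^{k+1} + y‖² }. Consequently, with v^k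 = τ u^k, the dual-form PrePDHG iteration coincides with ADMM applied to the dual problem minimize_z f*(−A^T z) + g*(z); i.e., ADMM is the special case of PrePDHG with M1 = τ^{-1} I_n and the optimal M2 = τ A A^T. -/
open Matrix Filter

noncomputable section

/-- A real constant added to both sides does not affect an inequality of extended reals. -/
theorem EReal.add_coe_le_add_coe_iff (x y : EReal) (c : ℝ) :
    x + (c : EReal) ≤ y + (c : EReal) ↔ x ≤ y := by
  refine ⟨fun h => ?_, fun h => by gcongr⟩
  have h' : x + (c : EReal) + ((-c : ℝ) : EReal) ≤ y + (c : EReal) + ((-c : ℝ) : EReal) := by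
    gcongr
  simpa only [add_assoc, ← EReal.coe_add, add_neg_cancel, EReal.coe_zero, add_zero] using h'

/-- Objectives whose real parts differ by a constant have the same minimizers. -/
theorem forall_add_coe_le_iff_of_eq_add_const {α : Type*} (φ : α → EReal) (q r : α → ℝ) (c : ℝ)
    (h : ∀ w, q w = r w + c) (p : α) :
    (∀ w, φ p + (q p : EReal) ≤ φ w + (q w : EReal)) ↔
      ∀ w, φ p + (r p : EReal) ≤ φ w + (r w : EReal) := by
  simp only [h, EReal.coe_add, ← add_assoc, EReal.add_coe_le_add_coe_iff]

theorem isProxPt_gram_iff {ι κ : Type*} [Fintype ι] [DecidableEq ι] [Fintype κ]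
    (φ : (ι → ℝ) → EReal) (A : Matrix ι κ ℝ) {τ : ℝ} (hτ : τ ≠ 0) (hA : IsUnit (A * Aᵀ).det)
    (z ζ : ι → ℝ) (y u : κ → ℝ) :
    IsProxPt (τ • (A * Aᵀ)) φ
        (z + (τ • (A * Aᵀ))⁻¹ *ᵥ (A *ᵥ (τ • (-(Aᵀ *ᵥ z) - y + u)))) ζ ↔
      ∀ w, φ ζ + ((τ * ((-(Aᵀ *ᵥ ζ) - y) ⬝ᵥ u) +
            τ / 2 * ((Aᵀ *ᵥ ζ + y) ⬝ᵥ (Aᵀ *ᵥ ζ + y)) : ℝ) : EReal) ≤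
          φ w + ((τ * ((-(Aᵀ *ᵥ w) - y) ⬝ᵥ u) +
            τ / 2 * ((Aᵀ *ᵥ w + y) ⬝ᵥ (Aᵀ *ᵥ w + y)) : ℝ) : EReal) := by
  set s := (τ • (A * Aᵀ))⁻¹ *ᵥ (A *ᵥ (τ • (-(Aᵀ *ᵥ z) - y + u))) with hs
  have hdet : IsUnit (τ • (A * Aᵀ)).det := by
    rw [Matrix.det_smul]
    exact ((isUnit_iff_ne_zero.mpr hτ).pow _).mul hA
  have hAs : A *ᵥ (Aᵀ *ᵥ s) = A *ᵥ (-(Aᵀ *ᵥ z) - y + u) := by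
    have h : (τ • (A * Aᵀ)) *ᵥ s = A *ᵥ (τ • (-(Aᵀ *ᵥ z) - y + u)) := by
      rw [hs, Matrix.mulVec_mulVec, Matrix.mul_nonsing_inv _ hdet, Matrix.one_mulVec]
    rw [Matrix.smul_mulVec, Matrix.mulVec_smul, ← Matrix.mulVec_mulVec] at h
    exact smul_right_injective _ hτ h
  have hadj (w : ι → ℝ) (x : κ → ℝ) : (Aᵀ *ᵥ w) ⬝ᵥ x = w ⬝ᵥ (A *ᵥ x) := by
    rw [Matrix.dotProduct_mulVec, Matrix.mulVec_transpose]
  have hw (w : ι → ℝ) :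
      (Aᵀ *ᵥ w) ⬝ᵥ (Aᵀ *ᵥ s) = (Aᵀ *ᵥ w) ⬝ᵥ (-(Aᵀ *ᵥ z) - y + u) := by
    rw [hadj, hadj, hAs]
  have hquad (w : ι → ℝ) :
      w ⬝ᵥ ((τ • (A * Aᵀ)) *ᵥ w) = τ * ((Aᵀ *ᵥ w) ⬝ᵥ (Aᵀ *ᵥ w)) := by
    rw [Matrix.smul_mulVec, dotProduct_smul, ← Matrix.mulVec_mulVec, ← hadj, smul_eq_mul]
  refine forall_add_coe_le_iff_of_eq_add_const φ
    (fun w => 1 / 2 * ((w - (z + s)) ⬝ᵥ (τ • (A * Aᵀ)) *ᵥ (w - (z + s))))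
    (fun w => τ * ((-(Aᵀ *ᵥ w) - y) ⬝ᵥ u) + τ / 2 * ((Aᵀ *ᵥ w + y) ⬝ᵥ (Aᵀ *ᵥ w + y)))
    (τ / 2 * ((Aᵀ *ᵥ (z + s)) ⬝ᵥ (Aᵀ *ᵥ (z + s))) + τ * (y ⬝ᵥ u) - τ / 2 * (y ⬝ᵥ y))
    (fun w => ?_) ζ
  have h := hw w
  simp only [hquad]
  simp only [Matrix.mulVec_add, Matrix.mulVec_sub, dotProduct_add, dotProduct_sub, add_dotProduct,
    sub_dotProduct, neg_dotProduct, dotProduct_neg] at h ⊢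
  rw [dotProduct_comm (Aᵀ *ᵥ z) (Aᵀ *ᵥ w), dotProduct_comm (Aᵀ *ᵥ s) (Aᵀ *ᵥ w),
    dotProduct_comm y (Aᵀ *ᵥ w)]
  linear_combination -τ * h

theorem isProxPt_smul_one_iff {κ : Type*} [Fintype κ] [DecidableEq κ]
    (φ : (κ → ℝ) → EReal) (τ : ℝ) (a u η : κ → ℝ) :
    IsProxPt (τ • (1 : Matrix κ κ ℝ)) φ (u - a) η ↔
      ∀ w, φ η + ((τ * ((-a - η) ⬝ᵥ u) + τ / 2 * ((a + η) ⬝ᵥ (a + η)) : ℝ) : EReal) ≤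
          φ w + ((τ * ((-a - w) ⬝ᵥ u) + τ / 2 * ((a + w) ⬝ᵥ (a + w)) : ℝ) : EReal) := by
  refine forall_add_coe_le_iff_of_eq_add_const φ
    (fun w => 1 / 2 * ((w - (u - a)) ⬝ᵥ (τ • (1 : Matrix κ κ ℝ)) *ᵥ (w - (u - a))))
    (fun w => τ * ((-a - w) ⬝ᵥ u) + τ / 2 * ((a + w) ⬝ᵥ (a + w))) (τ / 2 * (u ⬝ᵥ u))
    (fun w => ?_) η
  simp only [Matrix.smul_mulVec, Matrix.one_mulVec, dotProduct_smul, smul_eq_mul]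
  simp only [dotProduct_add, dotProduct_sub, add_dotProduct, sub_dotProduct, neg_dotProduct]
  rw [dotProduct_comm u w, dotProduct_comm u a, dotProduct_comm a w]
  ring

/-- ADMM as a special case of PrePDHG.  With `M1 = τ⁻¹I_n` and
`M2 = τAAᵀ` (with `AAᵀ` invertible), the preconditioned `z`- and `y`-updates coincide
with the corresponding ADMM subproblems, and, after rescaling `v^k = τu^k`, the dual
form of PrePDHG coincides with ADMM applied to the dual problem
`min_z f*(−Aᵀz) + g*(z)`. -/
theorem admm_special_case_of_prePDHG {n m : ℕ}
    (f : (Fin n → ℝ) → EReal) (g : (Fin m → ℝ) → EReal)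
    (hfp : ProperE f) (hfc : LowerSemicontinuous f) (hfv : ConvexE f)
    (hgp : ProperE g) (hgc : LowerSemicontinuous g) (hgv : ConvexE g)
    (A : Matrix (Fin m) (Fin n) ℝ)
    (τ : ℝ) (hτ : 0 < τ)
    (hAAT : IsUnit (A * Aᵀ).det)
    (M1 : Matrix (Fin n) (Fin n) ℝ) (hM1 : M1 = τ⁻¹ • (1 : Matrix (Fin n) (Fin n) ℝ))
    (M2 : Matrix (Fin m) (Fin m) ℝ) (hM2 : M2 = τ • (A * Aᵀ)) :
    (∀ (zk : Fin m → ℝ) (yk uk : Fin n → ℝ) (ζ : Fin m → ℝ),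
      IsProxPt M2 (conjE g)
          (zk + M2⁻¹.mulVec (A.mulVec (M1⁻¹.mulVec (-(Aᵀ.mulVec zk) - yk + uk)))) ζ ↔
        ∀ ww : Fin m → ℝ,
          conjE g ζ + ((τ * ((-(Aᵀ.mulVec ζ) - yk) ⬝ᵥ uk) +
              τ / 2 * ((Aᵀ.mulVec ζ + yk) ⬝ᵥ (Aᵀ.mulVec ζ + yk)) : ℝ) : EReal) ≤
          conjE g ww + ((τ * ((-(Aᵀ.mulVec ww) - yk) ⬝ᵥ uk) +
              τ / 2 * ((Aᵀ.mulVec ww + yk) ⬝ᵥ (Aᵀ.mulVec ww + yk)) : ℝ) : EReal)) ∧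
    (∀ (zk1 : Fin m → ℝ) (uk η : Fin n → ℝ),
      IsProxPt M1⁻¹ (conjE f) (uk - Aᵀ.mulVec zk1) η ↔
        ∀ ww : Fin n → ℝ,
          conjE f η + ((τ * ((-(Aᵀ.mulVec zk1) - η) ⬝ᵥ uk) +
              τ / 2 * ((Aᵀ.mulVec zk1 + η) ⬝ᵥ (Aᵀ.mulVec zk1 + η)) : ℝ) : EReal) ≤
          conjE f ww + ((τ * ((-(Aᵀ.mulVec zk1) - ww) ⬝ᵥ uk) +
              τ / 2 * ((Aᵀ.mulVec zk1 + ww) ⬝ᵥ (Aᵀ.mulVec zk1 + ww)) : ℝ) : EReal)) ∧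
    (∀ (z : ℕ → Fin m → ℝ) (y u : ℕ → Fin n → ℝ),
      (∀ k, IsProxPt M2 (conjE g)
        (z k + M2⁻¹.mulVec (A.mulVec (M1⁻¹.mulVec
          (-(Aᵀ.mulVec (z k)) - y k + u k)))) (z (k + 1))) →
      (∀ k, IsProxPt M1⁻¹ (conjE f) (u k - Aᵀ.mulVec (z (k + 1))) (y (k + 1))) →
      (∀ k, u (k + 1) = u k - Aᵀ.mulVec (z (k + 1)) - y (k + 1)) →
      ∀ k : ℕ,
        (∀ ww : Fin m → ℝ,
          conjE g (z (k + 1)) + (((-(Aᵀ.mulVec (z (k + 1))) - y k) ⬝ᵥ (τ • u k) +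
              τ / 2 * ((Aᵀ.mulVec (z (k + 1)) + y k) ⬝ᵥ
                (Aᵀ.mulVec (z (k + 1)) + y k)) : ℝ) : EReal) ≤
          conjE g ww + (((-(Aᵀ.mulVec ww) - y k) ⬝ᵥ (τ • u k) +
              τ / 2 * ((Aᵀ.mulVec ww + y k) ⬝ᵥ (Aᵀ.mulVec ww + y k)) : ℝ) : EReal)) ∧
        (∀ ww : Fin n → ℝ,
          conjE f (y (k + 1)) + (((-(Aᵀ.mulVec (z (k + 1))) - y (k + 1)) ⬝ᵥ (τ • u k) +
              τ / 2 * ((Aᵀ.mulVec (z (k + 1)) + y (k + 1)) ⬝ᵥ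
                (Aᵀ.mulVec (z (k + 1)) + y (k + 1))) : ℝ) : EReal) ≤
          conjE f ww + (((-(Aᵀ.mulVec (z (k + 1))) - ww) ⬝ᵥ (τ • u k) +
              τ / 2 * ((Aᵀ.mulVec (z (k + 1)) + ww) ⬝ᵥ
                (Aᵀ.mulVec (z (k + 1)) + ww)) : ℝ) : EReal)) ∧
        τ • u (k + 1) = τ • u k - τ • (Aᵀ.mulVec (z (k + 1)) + y (k + 1))) := by
  have hM1inv : M1⁻¹ = τ • (1 : Matrix (Fin n) (Fin n) ℝ) := by
    rw [hM1]
    apply Matrix.inv_eq_right_inv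
    rw [smul_mul_smul_comm, inv_mul_cancel₀ hτ.ne', one_smul, one_mul]
  have hz := isProxPt_gram_iff (conjE g) A hτ.ne' hAAT
  have hy := fun zk1 : Fin m → ℝ => isProxPt_smul_one_iff (conjE f) τ (Aᵀ *ᵥ zk1)
  subst hM2
  simp only [hM1inv, Matrix.smul_mulVec _ (1 : Matrix (Fin n) (Fin n) ℝ), Matrix.one_mulVec]
  refine ⟨fun zk yk uk ζ => hz zk ζ yk uk, hy, fun z y u hzk hyk huk k => ⟨?_, ?_, ?_⟩⟩
  · simpa only [dotProduct_smul, smul_eq_mul] using (hz _ _ _ _).mp (hzk k)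
  · simpa only [dotProduct_smul, smul_eq_mul] using (hy _ _ _).mp (hyk k)
  · rw [huk k, ← smul_sub, sub_sub]
end
end

section
/- Let D : ℝ^{M×N} → ℝ^{2M×N} be the 2D discrete gradient operator with grid step h: (Du)^1_{i,j} = (u_{i+1,j} − u_{i,j})/h if i < M and 0 if i = M; (Du)^2_{i,j} = (u_{i,j+1} − u_{i,j})/h if j < N and 0 if j = N. For (i,j) ∈ {1,…,M}×{1,…,N}, let e_{i,j} denote the corresponding standard basis element of ℝ^{M×N}. Then for any two distinct indices (i,j) ≠ (i′,j′) with i + j ≡ i′ + j′ (mod 2), the vectors D e_{i,j} and D e_{i′,j′} are orthogonal: ⟨D e_{i,j}, D e_{i′,j′}⟩ = 0. Consequently, splitting the coordinates of ℝ^{M×N} into the 'black' block {(i,j) : i+j even} and the 'red' block {(i,j) : i+j odd}, the Gram matrices L_b^T L_b and L_r^T L_r of the corresponding column submatrices L_b, L_r of D are diagonal. -/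
open Matrix

noncomputable section

/-- The 2D discrete gradient operator `D : ℝ^{M×N} → ℝ^{2M×N}` with grid step `h`,
given by forward differences with zero at the boundary. -/
def Dop (M N : ℕ) (h : ℝ) (u : Fin M → Fin N → ℝ) :
    (Fin M → Fin N → ℝ) × (Fin M → Fin N → ℝ) :=
  (fun i j => if hi : (i : ℕ) + 1 < M then (u ⟨(i : ℕ) + 1, hi⟩ j - u i j) / h else 0,
   fun i j => if hj : (j : ℕ) + 1 < N then (u i ⟨(j : ℕ) + 1, hj⟩ - u i j) / h else 0)

/-- The standard basis element of `ℝ^{M×N}` at position `p`. -/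
def basisE {M N : ℕ} (p : Fin M × Fin N) : Fin M → Fin N → ℝ :=
  fun i j => if i = p.1 ∧ j = p.2 then 1 else 0

/-- The Euclidean inner product on `ℝ^{2M×N} = ℝ^{M×N} × ℝ^{M×N}`. -/
def innerPair {M N : ℕ} (p q : (Fin M → Fin N → ℝ) × (Fin M → Fin N → ℝ)) : ℝ :=
  (∑ i, ∑ j, p.1 i j * q.1 i j) + ∑ i, ∑ j, p.2 i j * q.2 i j

/-- Each forward difference involves at most one grid point of each parity, so the columns of `Dop`
at distinct points of equal parity have disjoint supports. -/
theorem Dop_basisE_mul_eq_zero {M N : ℕ} (h : ℝ) {p q : Fin M × Fin N} (hpq : p ≠ q)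
    (hparity : ((p.1 : ℕ) + (p.2 : ℕ)) % 2 = ((q.1 : ℕ) + (q.2 : ℕ)) % 2)
    (i : Fin M) (j : Fin N) :
    (Dop M N h (basisE p)).1 i j * (Dop M N h (basisE q)).1 i j = 0 ∧
      (Dop M N h (basisE p)).2 i j * (Dop M N h (basisE q)).2 i j = 0 := by
  obtain ⟨⟨a, ha⟩, ⟨b, hb⟩⟩ := p
  obtain ⟨⟨c, hc⟩, ⟨d, hd⟩⟩ := q
  obtain ⟨i, hi⟩ := i
  obtain ⟨j, hj⟩ := j
  simp only [ne_eq, Prod.mk.injEq, Fin.mk.injEq] at hpq hparity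
  simp only [Dop, basisE, Fin.mk.injEq]
  constructor <;> split_ifs <;> first | omega | simp

/-- two-block red-black ordering.  For any two distinct grid indices
`p ≠ q` with the same parity of `i + j`, the columns `D e_p` and `D e_q` of the 2D
discrete gradient operator are orthogonal.  Equivalently, the Gram matrices
`L_bᵀL_b` and `L_rᵀL_r` of the black and red column submatrices of `D` are diagonal. -/
theorem redblack_columns_orthogonal (M N : ℕ) (h : ℝ) (hh : 0 < h)
    (p q : Fin M × Fin N) (hpq : p ≠ q)
    (hparity : ((p.1 : ℕ) + (p.2 : ℕ)) % 2 = ((q.1 : ℕ) + (q.2 : ℕ)) % 2) :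
    innerPair (Dop M N h (basisE p)) (Dop M N h (basisE q)) = 0 := by
  have hzero := Dop_basisE_mul_eq_zero h hpq hparity
  simp [innerPair, fun i j => (hzero i j).1, fun i j => (hzero i j).2]
end
end

section
/- Let D : ℝ^{M×N} → ℝ^{2M×N} be the 2D discrete gradient operator with grid step h (as defined componentwise via forward differences with zero at the boundary), and let D^T : ℝ^{2M×N} → ℝ^{M×N} be its adjoint. For p ∈ ℝ^{2M×N} write p = (p^1, p^2), and let e^1_{i,j}, e^2_{i,j} denote the standard basis elements supported on the first and second component at position (i,j), respectively. Then: (a) for distinct (i,j) ≠ (i′,j′) with i ≡ i′ (mod 2), ⟨D^T e^1_{i,j}, D^T e^1_{i′,j′}⟩ = 0; (b) for distinct (i,j) ≠ (i′,j′) with j ≡ j′ (mod 2), ⟨D^T e^2_{i,j}, D^T e^2_{i′,j′}⟩ = 0. Consequently, under the four-block splitting z_b = {z^1_{i,j} : i odd}, z_r = {z^1_{i,j} : i even}, z_y = {z^2_{i,j} : j odd}, z_g = {z^2_{i,j} : j even}, the Gram matrix of the columns of D^T within each block is diagonal. -/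
open Matrix

noncomputable section

/-- The Euclidean inner product on `ℝ^{M×N}`. -/
def innerGrid {M N : ℕ} (u v : Fin M → Fin N → ℝ) : ℝ := ∑ i, ∑ j, u i j * v i j

theorem innerGrid_basisE_left {M N : ℕ} (p : Fin M × Fin N) (v : Fin M → Fin N → ℝ) :
    innerGrid (basisE p) v = v p.1 p.2 := by
  simp [innerGrid, basisE, ite_and]

theorem innerPair_basisE_zero {M N : ℕ} (p : Fin M × Fin N)
    (v : (Fin M → Fin N → ℝ) × (Fin M → Fin N → ℝ)) :
    innerPair v (basisE p, 0) = v.1 p.1 p.2 := by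
  simp [innerPair, basisE, ite_and]

theorem innerPair_zero_basisE {M N : ℕ} (p : Fin M × Fin N)
    (v : (Fin M → Fin N → ℝ) × (Fin M → Fin N → ℝ)) :
    innerPair v (0, basisE p) = v.2 p.1 p.2 := by
  simp [innerPair, basisE, ite_and]

/-- four-block ordering for `Dᵀ`.  Let `DT` be the Euclidean adjoint of
the 2D discrete gradient operator `D`.  Then (a) for distinct `(i,j) ≠ (i′,j′)` with
`i ≡ i′ (mod 2)`, the columns `Dᵀe¹_{i,j}` and `Dᵀe¹_{i′,j′}` are orthogonal, and
(b) for distinct `(i,j) ≠ (i′,j′)` with `j ≡ j′ (mod 2)`, the columns `Dᵀe²_{i,j}` and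
`Dᵀe²_{i′,j′}` are orthogonal.  Consequently the Gram matrix of the columns of `Dᵀ`
within each of the four blocks `z_b, z_r, z_y, z_g` is diagonal. -/
theorem fourblock_columns_orthogonal (M N : ℕ) (h : ℝ) (hh : 0 < h)
    (DT : (Fin M → Fin N → ℝ) × (Fin M → Fin N → ℝ) → Fin M → Fin N → ℝ)
    (hDT : ∀ (u : Fin M → Fin N → ℝ) (pp : (Fin M → Fin N → ℝ) × (Fin M → Fin N → ℝ)),
      innerPair (Dop M N h u) pp = innerGrid u (DT pp)) :
    (∀ p q : Fin M × Fin N, p ≠ q → (p.1 : ℕ) % 2 = (q.1 : ℕ) % 2 →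
      innerGrid (DT (basisE p, 0)) (DT (basisE q, 0)) = 0) ∧
    (∀ p q : Fin M × Fin N, p ≠ q → (p.2 : ℕ) % 2 = (q.2 : ℕ) % 2 →
      innerGrid (DT (0, basisE p)) (DT (0, basisE q)) = 0) := by
  constructor
  · intro p q hpq hpar
    have hzero : ∀ i j, (j ≠ p.2 ∨ (i ≠ p.1 ∧ (i : ℕ) ≠ p.1 + 1)) →
        DT (basisE p, 0) i j = 0 := by
      intro i j hij
      rw [← innerGrid_basisE_left (i, j) (DT (basisE p, 0)), ← hDT, innerPair_basisE_zero]
      simp only [Dop, basisE]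
      grind
    rw [← hDT, innerPair_basisE_zero]
    have hne : q.2 ≠ p.2 ∨ q.1 ≠ p.1 := by
      grind
    simp only [Dop]
    split_ifs with hi
    · rw [hzero, hzero, sub_self, zero_div] <;> grind
    · rfl
  · intro p q hpq hpar
    have hzero : ∀ i j, (i ≠ p.1 ∨ (j ≠ p.2 ∧ (j : ℕ) ≠ p.2 + 1)) →
        DT (0, basisE p) i j = 0 := by
      intro i j hij
      rw [← innerGrid_basisE_left (i, j) (DT (0, basisE p)), ← hDT, innerPair_zero_basisE]
      simp only [Dop, basisE]
      grind
    rw [← hDT, innerPair_zero_basisE]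
    have hne : q.2 ≠ p.2 ∨ q.1 ≠ p.1 := by
      grind
    simp only [Dop]
    split_ifs with hj
    · rw [hzero, hzero, sub_self, zero_div] <;> grind
    · rfl
end
end

section
/- Let f be μ_f-strongly convex proper closed, g proper closed convex, A ∈ ℝ^{m×n}, M1, M2 symmetric positive definite, and L(z,y,u) = g*(z) + f*(y) + ⟨−A^T z − y, M1^{-1} u⟩ + ½‖A^T z + y‖²_{M1^{-1}}. Suppose the iterates satisfy the optimality conditions: 0 ∈ ∂g*(z^{k+1}) + M2(z^{k+1} − z^k − M2^{-1}AM1^{-1}(−A^T z^k − y^k + u^k)) + ε^{k+1}; 0 = ∇f*(y^{k+1}) − M1^{-1}u^{k+1}; u^{k+1} = u^k − A^T z^{k+1} − y^{k+1}; and also u^k = u^{k−1} − A^T z^k − y^k. Then the vector d^{k+1} = (d^{k+1}_z, d^{k+1}_y, d^{k+1}_u) with d^{k+1}_z = M2(z^k − z^{k+1}) + 2AM1^{-1}(u^k − u^{k+1}) − AM1^{-1}(u^{k−1} − u^k) − ε^{k+1}, d^{k+1}_y = M1^{-1}(u^k − u^{k+1}), d^{k+1}_u = M1^{-1}(u^{k+1}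 − u^k) satisfies d^{k+1} ∈ ∂L(z^{k+1}, y^{k+1}, u^{k+1}). In particular, ‖d^{k+1}‖ is bounded by a constant multiple of ‖z^k − z^{k+1}‖ + ‖u^{k−1} − u^k‖ + ‖u^k − u^{k+1}‖ + ‖ε^{k+1}‖. -/
open Matrix Filter

noncomputable section

theorem nrm_eq_norm_toLp {ι : Type*} [Fintype ι] (x : ι → ℝ) :
    nrm x = ‖WithLp.toLp 2 x‖ := by
  simp [nrm, EuclideanSpace.norm_eq, dotProduct, sq]

theorem nrm_nonneg_s18 {ι : Type*} [Fintype ι] (x : ι → ℝ) : 0 ≤ nrm x :=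
  Real.sqrt_nonneg _

theorem nrm_add_le_s18 {ι : Type*} [Fintype ι] (x y : ι → ℝ) : nrm (x + y) ≤ nrm x + nrm y := by
  simpa only [nrm_eq_norm_toLp, WithLp.toLp_add] using norm_add_le _ _

theorem nrm_sub_le_s18 {ι : Type*} [Fintype ι] (x y : ι → ℝ) : nrm (x - y) ≤ nrm x + nrm y := by
  simpa only [nrm_eq_norm_toLp, WithLp.toLp_sub] using norm_sub_le _ _

theorem nrm_sub_comm {ι : Type*} [Fintype ι] (x y : ι → ℝ) : nrm (x - y) = nrm (y - x) := by
  simpa only [nrm_eq_norm_toLp, WithLp.toLp_sub] using norm_sub_rev _ _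

theorem nrm_smul_s18 {ι : Type*} [Fintype ι] (c : ℝ) (x : ι → ℝ) : nrm (c • x) = |c| * nrm x := by
  simp only [nrm_eq_norm_toLp, WithLp.toLp_smul, norm_smul, Real.norm_eq_abs]

open scoped Matrix.Norms.L2Operator in
theorem exists_nrm_mulVec_le {ι κ : Type*} [Fintype ι] [Fintype κ] (B : Matrix ι κ ℝ) :
    ∃ c : ℝ, 0 ≤ c ∧ ∀ x, nrm (B.mulVec x) ≤ c * nrm x := by
  classical
  refine ⟨‖B‖, norm_nonneg _, fun x => ?_⟩
  simp only [nrm_eq_norm_toLp]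
  exact Matrix.l2_opNorm_mulVec B (WithLp.toLp 2 x)

/-- subgradient bound at the iterates.  Under the optimality conditions
of the inexact preconditioned ADMM iteration (with `∇f*` expressed via the subgradient
map `Gf` of `f*`), the vector `d^{k+1} = (d_z, d_y, d_u)` with
`d_z = M2(z^k − z^{k+1}) + 2AM1⁻¹(u^k − u^{k+1}) − AM1⁻¹(u^{k−1} − u^k) − ε^{k+1}`,
`d_y = M1⁻¹(u^k − u^{k+1})`, `d_u = M1⁻¹(u^{k+1} − u^k)` belongs to
`∂L(z^{k+1}, y^{k+1}, u^{k+1})`, i.e. its components match the partial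
subdifferentials `∂_zL = ∂g*(z) − AM1⁻¹u + AM1⁻¹(Aᵀz + y)`,
`∇_yL = ∇f*(y) − M1⁻¹u + M1⁻¹(Aᵀz + y)`, `∇_uL = M1⁻¹(−Aᵀz − y)`; in particular its
norm is bounded by a constant multiple of
`‖z^k − z^{k+1}‖ + ‖u^{k−1} − u^k‖ + ‖u^k − u^{k+1}‖ + ‖ε^{k+1}‖`. -/
theorem inexact_admm_subgradient_bound {n m : ℕ}
    (f : (Fin n → ℝ) → EReal) (g : (Fin m → ℝ) → EReal)
    (μ : ℝ) (hμ : 0 < μ)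
    (hfp : ProperE f) (hfc : LowerSemicontinuous f) (hfsc : StrongConvexE μ f)
    (hgp : ProperE g) (hgc : LowerSemicontinuous g) (hgv : ConvexE g)
    (A : Matrix (Fin m) (Fin n) ℝ)
    (M1 : Matrix (Fin n) (Fin n) ℝ) (M2 : Matrix (Fin m) (Fin m) ℝ)
    (hM1 : M1.PosDef) (hM2 : M2.PosDef)
    (Gf : (Fin n → ℝ) → Fin n → ℝ)
    (hGf : ∀ yy : Fin n → ℝ, SubgradAt (conjE f) yy (Gf yy))
    (z : ℕ → Fin m → ℝ) (y u : ℕ → Fin n → ℝ) (ε : ℕ → Fin m → ℝ)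
    (hz : ∀ k, SubgradAt (conjE g) (z (k + 1))
      (-(M2.mulVec (z (k + 1) - z k - M2⁻¹.mulVec (A.mulVec (M1⁻¹.mulVec
          (-(Aᵀ.mulVec (z k)) - y k + u k))))) - ε (k + 1)))
    (hgrad : ∀ k, Gf (y (k + 1)) = M1⁻¹.mulVec (u (k + 1)))
    (hu : ∀ k, u (k + 1) = u k - Aᵀ.mulVec (z (k + 1)) - y (k + 1))
    (dz : ℕ → Fin m → ℝ) (dy du : ℕ → Fin n → ℝ)
    (hdz : ∀ k, dz (k + 1) = M2.mulVec (z k - z (k + 1)) +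
      (2 : ℝ) • A.mulVec (M1⁻¹.mulVec (u k - u (k + 1))) -
      A.mulVec (M1⁻¹.mulVec (u (k - 1) - u k)) - ε (k + 1))
    (hdy : ∀ k, dy (k + 1) = M1⁻¹.mulVec (u k - u (k + 1)))
    (hdu : ∀ k, du (k + 1) = M1⁻¹.mulVec (u (k + 1) - u k)) :
    (∀ k : ℕ, 1 ≤ k →
      SubgradAt (conjE g) (z (k + 1))
        (dz (k + 1) + A.mulVec (M1⁻¹.mulVec (u (k + 1))) -
          A.mulVec (M1⁻¹.mulVec (Aᵀ.mulVec (z (k + 1)) + y (k + 1)))) ∧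
      dy (k + 1) = Gf (y (k + 1)) - M1⁻¹.mulVec (u (k + 1)) +
        M1⁻¹.mulVec (Aᵀ.mulVec (z (k + 1)) + y (k + 1)) ∧
      du (k + 1) = M1⁻¹.mulVec (-(Aᵀ.mulVec (z (k + 1))) - y (k + 1))) ∧
    (∃ C : ℝ, 0 < C ∧ ∀ k : ℕ, 1 ≤ k →
      nrm (dz (k + 1)) + nrm (dy (k + 1)) + nrm (du (k + 1)) ≤
        C * (nrm (z k - z (k + 1)) + nrm (u (k - 1) - u k) +
          nrm (u k - u (k + 1)) + nrm (ε (k + 1)))) := by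
  have hres (k : ℕ) : Aᵀ.mulVec (z (k + 1)) + y (k + 1) = u k - u (k + 1) := by
    rw [hu k]; abel
  refine ⟨fun k hk => ⟨?_, ?_, ?_⟩, ?_⟩
  · obtain ⟨j, rfl⟩ := Nat.exists_eq_add_of_le' hk
    have hsub := hz (j + 1)
    have hneg : -(Aᵀ.mulVec (z (j + 1))) - y (j + 1) = u (j + 1) - u j := by
      rw [hu j]; abel
    have hM2inv (w : Fin m → ℝ) : M2.mulVec (M2⁻¹.mulVec w) = w := by
      rw [Matrix.mulVec_mulVec, Matrix.mul_nonsing_inv _ hM2.det_pos.ne'.isUnit,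
        Matrix.one_mulVec]
    rw [hneg] at hsub
    convert hsub using 1
    rw [hdz, hres]
    simp only [Nat.add_sub_cancel, Matrix.mulVec_sub, Matrix.mulVec_add, hM2inv]
    module
  · rw [hdy, hgrad, hres, sub_self, zero_add]
  · rw [hdu, ← neg_sub (u k), ← hres]
    congr 1
    abel
  · obtain ⟨a, ha, hMz⟩ := exists_nrm_mulVec_le M2
    obtain ⟨b, hb, hAM⟩ := exists_nrm_mulVec_le (A * M1⁻¹)
    obtain ⟨c, hc, hMu⟩ := exists_nrm_mulVec_le M1⁻¹
    refine ⟨a + 2 * b + 2 * c + 1, by positivity, fun k _ => ?_⟩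
    have hz_le : nrm (dz (k + 1)) ≤ a * nrm (z k - z (k + 1)) +
        2 * (b * nrm (u k - u (k + 1))) + b * nrm (u (k - 1) - u k) + nrm (ε (k + 1)) := by
      rw [hdz, Matrix.mulVec_mulVec, Matrix.mulVec_mulVec]
      refine (nrm_sub_le_s18 _ _).trans (add_le_add_left ?_ _)
      refine (nrm_sub_le_s18 _ _).trans (add_le_add ?_ (hAM _))
      refine (nrm_add_le_s18 _ _).trans (add_le_add (hMz _) ?_)
      rw [nrm_smul_s18, abs_two]
      exact mul_le_mul_of_nonneg_left (hAM _) zero_le_two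
    have hy_le : nrm (dy (k + 1)) ≤ c * nrm (u k - u (k + 1)) := by
      rw [hdy]
      exact hMu _
    have hu_le : nrm (du (k + 1)) ≤ c * nrm (u k - u (k + 1)) := by
      rw [hdu, nrm_sub_comm (u k)]
      exact hMu _
    have hp := nrm_nonneg_s18 (z k - z (k + 1))
    have hq := nrm_nonneg_s18 (u (k - 1) - u k)
    have hr := nrm_nonneg_s18 (u k - u (k + 1))
    have hs := nrm_nonneg_s18 (ε (k + 1))
    generalize nrm (z k - z (k + 1)) = p at *
    generalize nrm (u (k - 1) - u k) = q at *
    generalize nrm (u k - u (k + 1)) = r at *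
    generalize nrm (ε (k + 1)) = s at *
    have h₁ : 0 ≤ (2 * b + 2 * c + 1) * p := by positivity
    have h₂ : 0 ≤ (a + b + 2 * c + 1) * q := by positivity
    have h₃ : 0 ≤ (a + 1) * r := by positivity
    have h₄ : 0 ≤ (a + 2 * b + 2 * c) * s := by positivity
    linarith
end
end
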